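/- For every δ > 0 there exists τ > 0 such that for every ν > 0 and every ε > 0 there exists n₀ ∈ ℕ such that the following holds for every n ≥ n₀, every integer d ≥ δn, and every positive integer r ≤ n^{1/50}: let G be a d-regular balanced bipartite graph with parts of size n which is a bipartite robust (ν,τ)-expander, and let N be either a matching in G or a spanning r-regular subgraph of G. Let M be a uniformly random perfect matching of G, X := |M ∩ E(N)|, and let Y be a Poisson random variable with parameter e(N)/d. Then for every edge e ∈ E(G) one has (1−ε)/d ≤ P[e ∈ M] ≤ (1+ε)/d, and d_TV(X,Y) ≤ ε. -/

import Mathlib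

open Finset

namespace RPM

/-- The `ν`-robust neighbourhood of a vertex set `S` in a graph `G` on `n` vertices:
all vertices having at least `ν * n` neighbours in `S`. -/
def RN {V : Type*} [Fintype V] (G : SimpleGraph V) (ν : ℝ) (S : Set V) : Set V :=
  {v : V | ν * (Fintype.card V : ℝ) ≤ (Nat.card {u : V | u ∈ S ∧ G.Adj v u} : ℝ)}

/-- `G` is a robust `(ν, τ)`-expander. -/
def RobustExpander {V : Type*} [Fintype V] (G : SimpleGraph V) (ν τ : ℝ) : Prop :=
  ∀ S : Set V,
    τ * (Fintype.card V : ℝ) ≤ (Nat.card S : ℝ) →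
    (Nat.card S : ℝ) ≤ (1 - τ) * (Fintype.card V : ℝ) →
    (Nat.card S : ℝ) + ν * (Fintype.card V : ℝ) ≤ (Nat.card (RN G ν S) : ℝ)

/-- `M` (a set of edges) is a perfect matching of `G`: its edges are edges of `G`,
and every vertex lies in exactly one edge of `M` (in particular the edges are
pairwise disjoint and cover all vertices). -/
def IsPM {V : Type*} (G : SimpleGraph V) (M : Finset (Sym2 V)) : Prop :=
  (∀ e ∈ M, e ∈ G.edgeSet) ∧ ∀ v : V, ∃! e, e ∈ M ∧ v ∈ e

/-- The number of perfect matchings of `G`. -/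
noncomputable def pmCount {V : Type*} (G : SimpleGraph V) : ℕ :=
  Nat.card {M : Finset (Sym2 V) // IsPM G M}

/-- `N` (a set of edges) is a matching in `G`: edges of `G`, pairwise disjoint. -/
def IsMatchingIn {V : Type*} (G : SimpleGraph V) (N : Finset (Sym2 V)) : Prop :=
  (∀ e ∈ N, e ∈ G.edgeSet) ∧ ∀ e ∈ N, ∀ f ∈ N, e ≠ f → ∀ v : V, v ∈ e → v ∉ f

/-- `G` is `d`-regular: every vertex has exactly `d` neighbours. -/
def RegularDeg {V : Type*} (G : SimpleGraph V) (d : ℕ) : Prop :=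
  ∀ v : V, Nat.card {u : V | G.Adj v u} = d

/-- Probability that a uniformly random perfect matching of `G` contains the edge `e`. -/
noncomputable def edgeProb {V : Type*} (G : SimpleGraph V) (e : Sym2 V) : ℝ :=
  (Nat.card {M : Finset (Sym2 V) // IsPM G M ∧ e ∈ M} : ℝ) / (pmCount G : ℝ)

/-- `P[X = k]` where `X = |M ∩ N|` for a uniformly random perfect matching `M` of `G`. -/
noncomputable def interProb {V : Type*} [DecidableEq V] (G : SimpleGraph V)
    (N : Finset (Sym2 V)) (k : ℕ) : ℝ :=
  (Nat.card {M : Finset (Sym2 V) // IsPM G M ∧ (M ∩ N).card = k} : ℝ) / (pmCount G : ℝ)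

/-- The Poisson probability mass function with parameter `lam`. -/
noncomputable def poissonPMF (lam : ℝ) (k : ℕ) : ℝ :=
  Real.exp (-lam) * lam ^ k / (Nat.factorial k)

/-- `N` (a set of edges) is a spanning `r`-regular subgraph of `G`: all edges of `N`
are edges of `G` and every vertex lies in exactly `r` edges of `N`. -/
def SpanningRegular {V : Type*} (G : SimpleGraph V) (N : Finset (Sym2 V)) (r : ℕ) : Prop :=
  (∀ e ∈ N, e ∈ G.edgeSet) ∧ ∀ v : V, Nat.card {e : Sym2 V // e ∈ N ∧ v ∈ e} = r

section Walks

open scoped Classical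

variable {α : Type*} [Fintype α]

/-- The walks of length `k` from `x` to `y` in the digraph `R`, as lists of vertices. -/
noncomputable def walks (R : α → α → Prop) : ℕ → α → α → Finset (List α)
  | 0, x, y => if x = y then {[x]} else ∅
  | k + 1, x, y =>
    (univ.filter (R x)).biUnion fun z => (walks R k z y).image (List.cons x)

/-- The number of walks of length `k` from `x` to `y` satisfying `Q`. -/
noncomputable def walkCount (R : α → α → Prop) (k : ℕ) (x y : α) (Q : List α → Prop) : ℝ :=
  (((walks R k x y).filter Q).card : ℝ)

lemma mem_walks {R : α → α → Prop} {k : ℕ} {x y : α} {l : List α} :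
    l ∈ walks R k x y ↔
      l.length = k + 1 ∧ l.head? = some x ∧ l.getLast? = some y ∧ l.IsChain R := by
  induction k generalizing x l with
  | zero =>
    rcases l with _ | ⟨u, _ | ⟨v, l⟩⟩ <;> by_cases h : x = y <;>
      simp [walks, h]
    grind
  | succ k ih =>
    simp only [walks, mem_biUnion, mem_filter, mem_univ, true_and, mem_image]
    constructor
    · rintro ⟨z, hz, l', hl', rfl⟩
      obtain ⟨h1, h2, h3, h4⟩ := ih.1 hl'
      rcases l' with _ | ⟨u, l'⟩
      · simp at h1
      · simp at h2
        subst h2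
        simp_all
    · rintro ⟨h1, h2, h3, h4⟩
      rcases l with _ | ⟨u, _ | ⟨v, l⟩⟩
      · simp at h1
      · simp at h1
      · simp at h2
        subst h2
        rw [List.isChain_cons_cons] at h4
        exact ⟨v, h4.1, v :: l, ih.2 ⟨by simpa using h1, rfl, by simpa using h3, h4.2⟩, rfl⟩

lemma exists_cons_of_mem_walks {R : α → α → Prop} {k : ℕ} {x y : α} {l : List α}
    (h : l ∈ walks R k x y) : ∃ l', l = x :: l' := by
  obtain ⟨-, h2, -, -⟩ := mem_walks.1 h
  rcases l with _ | ⟨u, l⟩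
  · simp at h2
  · simp at h2
    exact ⟨l, by rw [h2]⟩

lemma last_mem_of_mem_walks {R : α → α → Prop} {k : ℕ} {x y : α} {l : List α}
    (h : l ∈ walks R k x y) : y ∈ l :=
  List.mem_of_getLast? (mem_walks.1 h).2.2.1

lemma ne_of_mem_walks_of_nodup {R : α → α → Prop} {k : ℕ} (hk : 1 ≤ k) {z a : α} {l : List α}
    (h : l ∈ walks R k z a) (hl : l.Nodup) : z ≠ a := by
  obtain ⟨h1, h2, h3, -⟩ := mem_walks.1 h
  rcases l with _ | ⟨u, _ | ⟨v, l⟩⟩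
  · simp at h2
  · simp at h1; omega
  · simp at h2
    subst h2
    rintro rfl
    rw [List.getLast?_cons_cons] at h3
    exact (List.nodup_cons.1 hl).1 (List.mem_of_getLast? h3)

lemma walkCount_mono {R : α → α → Prop} {k : ℕ} {x y : α} {Q Q' : List α → Prop}
    (h : ∀ l ∈ walks R k x y, Q l → Q' l) : walkCount R k x y Q ≤ walkCount R k x y Q' := by
  unfold walkCount
  exact_mod_cast card_le_card fun l hl => by
    rw [mem_filter] at hl ⊢
    exact ⟨hl.1, h l hl.1 hl.2⟩

lemma walkCount_le_add {R : α → α → Prop} {k : ℕ} {x y : α} {Q Q₁ Q₂ : List α → Prop}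
    (h : ∀ l ∈ walks R k x y, Q l → Q₁ l ∨ Q₂ l) :
    walkCount R k x y Q ≤ walkCount R k x y Q₁ + walkCount R k x y Q₂ := by
  unfold walkCount
  norm_cast
  refine (card_le_card fun l hl => ?_).trans (card_union_le _ _)
  rw [mem_filter] at hl
  simp only [mem_union, mem_filter]
  exact (h l hl.1 hl.2).imp (fun h' => ⟨hl.1, h'⟩) (fun h' => ⟨hl.1, h'⟩)

lemma walkCount_eq_zero {R : α → α → Prop} {k : ℕ} {x y : α} {Q : List α → Prop}
    (h : ∀ l ∈ walks R k x y, ¬ Q l) : walkCount R k x y Q = 0 := by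
  simp [walkCount, filter_eq_empty_iff]
  exact h

lemma walkCount_succ (R : α → α → Prop) (k : ℕ) (x y : α) (Q : List α → Prop) :
    walkCount R (k + 1) x y Q =
      ∑ z with R x z, walkCount R k z y (fun l => Q (x :: l)) := by
  simp only [walkCount, walks, filter_biUnion]
  rw [card_biUnion, Nat.cast_sum]
  · refine sum_congr rfl fun z _ => ?_
    rw [filter_image, card_image_of_injective _ (List.cons_injective)]
  · intro z _ z' _ hzz
    rw [Function.onFun, disjoint_left]
    intro l hl hl'
    simp only [mem_filter, mem_image] at hl hl'
    obtain ⟨⟨m, hm, rfl⟩, -⟩ := hl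
    obtain ⟨⟨m', hm', h⟩, -⟩ := hl'
    obtain rfl : m' = m := by simpa using h
    have h1 := (mem_walks.1 hm).2.1
    have h2 := (mem_walks.1 hm').2.1
    rw [h1] at h2
    exact hzz (by simpa using h2)

/-- Every vertex has exactly `d` out-neighbours and `d` in-neighbours. -/
structure BiRegular (R : α → α → Prop) (d : ℕ) : Prop where
  out : ∀ x, (univ.filter fun z => R x z).card = d
  inn : ∀ y, (univ.filter fun z => R z y).card = d

lemma BiRegular.swap {R : α → α → Prop} {d : ℕ} (h : BiRegular R d) :
    BiRegular (fun x y => R y x) d := ⟨h.inn, h.out⟩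

variable {R : α → α → Prop} {d : ℕ}

lemma sum_out_le (hR : BiRegular R d) (x : α) (f : α → ℝ) (c : ℝ) (h : ∀ z, f z ≤ c) :
    ∑ z with R x z, f z ≤ d * c := by
  calc _ ≤ ∑ z with R x z, c := sum_le_sum fun z _ => h z
    _ = d * c := by rw [sum_const, hR.out, nsmul_eq_mul]

lemma sum_out_le_add (hR : BiRegular R d) (x v : α) (f : α → ℝ) {c c' : ℝ} (hc : 0 ≤ c)
    (hc' : 0 ≤ c') (h : ∀ z, z ≠ v → f z ≤ c) (h' : f v ≤ c') :
    ∑ z with R x z, f z ≤ d * c + c' := by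
  calc _ ≤ ∑ z with R x z, (c + if z = v then c' else 0) := sum_le_sum fun z _ => by
        split_ifs with hz
        · subst hz; linarith
        · simpa using h z hz
    _ ≤ d * c + c' := by
        rw [sum_add_distrib, sum_const, hR.out, nsmul_eq_mul, sum_ite_eq']
        split_ifs <;> linarith

lemma walkCount_le_one (x y : α) (Q : List α → Prop) : walkCount R 0 x y Q ≤ 1 := by
  unfold walkCount
  norm_cast
  refine (card_filter_le _ _).trans ?_
  simp only [walks]
  split_ifs <;> simp

lemma walkCount_zero_of_ne {x y : α} (h : x ≠ y) (Q : List α → Prop) :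
    walkCount R 0 x y Q = 0 := by
  simp [walkCount, walks, h]

lemma walkCount_le_pow (hR : BiRegular R d) (k : ℕ) (x y : α) (Q : List α → Prop) :
    walkCount R (k + 1) x y Q ≤ (d : ℝ) ^ k := by
  induction k generalizing x Q with
  | zero =>
    rw [walkCount_succ]
    have := sum_out_le_add hR x y (fun z => walkCount R 0 z y fun l => Q (x :: l)) le_rfl
      zero_le_one (fun z hz => (walkCount_zero_of_ne hz _).le) (walkCount_le_one y y _)
    simpa using this
  | succ k ih =>
    rw [walkCount_succ, pow_succ']
    exact sum_out_le hR x _ _ fun z => ih z _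

lemma walkCount_mem_le (hR : BiRegular R d) (hd : 1 ≤ d) (k : ℕ) {x v y : α} (hx : x ≠ v)
    (hy : v ≠ y) : walkCount R k x y (fun l => v ∈ l) ≤ k * (d : ℝ) ^ k / (d : ℝ) ^ 2 := by
  have hd' : (1 : ℝ) ≤ d := by exact_mod_cast hd
  induction k generalizing x with
  | zero =>
    rw [walkCount_eq_zero]
    · simp
    · intro l hl
      obtain ⟨h1, h2, h3, -⟩ := mem_walks.1 hl
      obtain ⟨l', rfl⟩ := exists_cons_of_mem_walks hl
      simp at h1
      subst h1
      simpa using hx.symm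
  | succ k ih =>
    rw [walkCount_succ]
    have h1 : walkCount R k v y (fun l => v ∈ x :: l) ≤ (d : ℝ) ^ (k + 1) / (d : ℝ) ^ 2 := by
      rcases k with _ | k
      · rw [walkCount_zero_of_ne hy]; positivity
      · refine (walkCount_le_pow hR k v y _).trans_eq ?_
        field_simp
        ring
    have := sum_out_le_add hR x v (fun z => walkCount R k z y fun l => v ∈ x :: l)
      (c := k * (d : ℝ) ^ k / (d : ℝ) ^ 2) (by positivity) (by positivity)
      (fun z hz => (walkCount_mono fun l _ h => by
        simpa [hx.symm] using h).trans (ih hz)) h1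
    refine this.trans_eq ?_
    push_cast
    ring

lemma walkCount_not_nodup_le (hR : BiRegular R d) (hd : 1 ≤ d) (k : ℕ) {x y : α} (hx : x ≠ y) :
    walkCount R k x y (fun l => ¬ l.Nodup) ≤ ((k : ℝ) + 1) ^ 2 * (d : ℝ) ^ k / (d : ℝ) ^ 2 := by
  have hd' : (1 : ℝ) ≤ d := by exact_mod_cast hd
  induction k generalizing x with
  | zero =>
    rw [walkCount_zero_of_ne hx]; positivity
  | succ k ih =>
    have h1 : ∀ Q, ∀ u, u ≠ y ∨ (∀ l ∈ walks R 0 u y, ¬ Q l) →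
        walkCount R k u y Q ≤ (d : ℝ) ^ (k + 1) / (d : ℝ) ^ 2 := by
      intro Q u hu
      rcases k with _ | k
      · rcases hu with hu | hu
        · rw [walkCount_zero_of_ne hu]; positivity
        · rw [walkCount_eq_zero hu]; positivity
      · refine (walkCount_le_pow hR k u y _).trans_eq ?_
        field_simp
        ring
    have hA := sum_out_le_add hR x y (fun z => walkCount R k z y fun l => ¬ l.Nodup)
      (c := ((k : ℝ) + 1) ^ 2 * (d : ℝ) ^ k / (d : ℝ) ^ 2) (by positivity) (by positivity)
      (fun z hz => ih hz) (h1 _ y (Or.inr fun l hl => by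
        simp [walks] at hl
        simp [hl]))
    have hB := sum_out_le_add hR x x (fun z => walkCount R k z y fun l => x ∈ l)
      (c := k * (d : ℝ) ^ k / (d : ℝ) ^ 2) (by positivity) (by positivity)
      (fun z hz => walkCount_mem_le hR hd k hz hx) (h1 _ x (Or.inl hx))
    rw [walkCount_succ]
    calc _ ≤ ∑ z with R x z, (walkCount R k z y (fun l => ¬ l.Nodup) +
            walkCount R k z y (fun l => x ∈ l)) :=
          sum_le_sum fun z _ => walkCount_le_add fun l _ h => by
            rw [List.nodup_cons] at h
            tauto
      _ ≤ _ := by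
          rw [sum_add_distrib]
          refine (add_le_add hA hB).trans ?_
          rw [pow_succ (d : ℝ) k]
          have : (0 : ℝ) ≤ (d : ℝ) ^ k * d / (d : ℝ) ^ 2 := by positivity
          push_cast
          have e : (d * (((k : ℝ) + 1) ^ 2 * (d : ℝ) ^ k / (d : ℝ) ^ 2) +
              (d : ℝ) ^ k * d / (d : ℝ) ^ 2) + (d * (k * (d : ℝ) ^ k / (d : ℝ) ^ 2) +
              (d : ℝ) ^ k * d / (d : ℝ) ^ 2) =
              (((k : ℝ) + 1) ^ 2 + k + 2) * ((d : ℝ) ^ k * d / (d : ℝ) ^ 2) := by ring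
          rw [e, mul_div_assoc _ (_ * _)]
          refine mul_le_mul_of_nonneg_right ?_ this
          nlinarith [Nat.cast_nonneg (α := ℝ) k]

lemma walkCount_bad_le (hR : BiRegular R d) (hd : 1 ≤ d) {S : α → α → Prop} {r : ℕ}
    (hout : ∀ x, (univ.filter fun z => R x z ∧ ¬ S x z).card ≤ r)
    (hin : ∀ y, (univ.filter fun z => R z y ∧ ¬ S z y).card ≤ r) (k : ℕ) (x y : α) :
    walkCount R (k + 2) x y (fun l => ¬ l.IsChain S) ≤ ((k : ℝ) + 2) * r * (d : ℝ) ^ k := by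
  have hd' : (1 : ℝ) ≤ d := by exact_mod_cast hd
  have step : ∀ k x, walkCount R (k + 1) x y (fun l => ¬ l.IsChain S) ≤
      ∑ z with R x z, walkCount R k z y (fun l => ¬ l.IsChain S) +
      ∑ z with R x z ∧ ¬ S x z, walkCount R k z y (fun _ => True) := by
    intro k x
    rw [walkCount_succ, ← filter_filter, sum_filter (fun z => ¬ S x z), ← sum_add_distrib]
    refine sum_le_sum fun z _ => ?_
    split_ifs with h
    · rw [add_zero]
      refine walkCount_mono fun l hl h' => ?_
      obtain ⟨l', rfl⟩ := exists_cons_of_mem_walks hl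
      rw [List.isChain_cons_cons] at h'
      tauto
    · exact walkCount_le_add fun l _ _ => Or.inr trivial
  have two : ∀ k x, ∑ z with R x z ∧ ¬ S x z, walkCount R (k + 1) z y (fun _ => True) ≤
      r * (d : ℝ) ^ k := by
    intro k x
    refine (sum_le_card_nsmul _ _ _ fun z _ => walkCount_le_pow hR k z y _).trans ?_
    rw [nsmul_eq_mul]
    exact mul_le_mul_of_nonneg_right (by exact_mod_cast hout x) (by positivity)
  induction k generalizing x with
  | zero =>
    refine (step 1 x).trans ?_
    have h1 : ∑ z with R x z, walkCount R 1 z y (fun l => ¬ l.IsChain S) ≤ r := by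
      calc _ ≤ ∑ z with R x z, (if R z y ∧ ¬ S z y then (1 : ℝ) else 0) := by
            refine sum_le_sum fun z _ => ?_
            split_ifs with h
            · simpa using walkCount_le_pow hR 0 z y _
            · refine (walkCount_eq_zero fun l hl => ?_).le
              obtain ⟨h1, h2, h3, h4⟩ := mem_walks.1 hl
              rcases l with _ | ⟨u, _ | ⟨v, _ | ⟨w, l⟩⟩⟩ <;> simp_all
        _ ≤ ∑ z, (if R z y ∧ ¬ S z y then (1 : ℝ) else 0) :=
            sum_le_sum_of_subset_of_nonneg (filter_subset _ _) fun _ _ _ => by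
              split_ifs <;> norm_num
        _ ≤ r := by
            rw [sum_boole]; exact_mod_cast hin y
    have := two 0 x
    simp at this ⊢
    linarith
  | succ k ih =>
    refine (step (k + 2) x).trans ?_
    have h1 := sum_out_le hR x _ _ fun z => ih z
    have h2 := two (k + 1) x
    rw [pow_succ] at h2 ⊢
    push_cast
    linarith

end Walks

section Mixing

open scoped Classical

variable {α : Type*} [Fintype α]

/-- The transition matrix of the simple random walk on a `d`-regular digraph. -/
noncomputable def stepMatrix (R : α → α → Prop) (d : ℕ) : Matrix α α ℝ :=
  fun x y => if R x y then (d : ℝ)⁻¹ else 0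

lemma stepMatrix_mul_apply (R : α → α → Prop) (d : ℕ) (M : Matrix α α ℝ) (x y : α) :
    (stepMatrix R d * M) x y = (d : ℝ)⁻¹ * ∑ z with R x z, M z y := by
  simp [Matrix.mul_apply, stepMatrix, sum_filter, mul_sum]

lemma walkCount_eq_stepMatrix_pow (R : α → α → Prop) {d : ℕ} (hd : 1 ≤ d) (k : ℕ) (x y : α) :
    walkCount R k x y (fun _ => True) = (d : ℝ) ^ k * (stepMatrix R d ^ k) x y := by
  have hd' : (d : ℝ) ≠ 0 := by positivity
  induction k generalizing x with
  | zero =>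
    by_cases h : x = y <;> simp [walkCount, walks, h]
  | succ k ih =>
    rw [walkCount_succ, pow_succ' (stepMatrix R d), stepMatrix_mul_apply]
    simp only [ih]
    rw [← mul_sum]
    field_simp
    ring

lemma stepMatrix_mem_doublyStochastic {R : α → α → Prop} {d : ℕ} (hR : BiRegular R d)
    (hd : 1 ≤ d) : stepMatrix R d ∈ doublyStochastic ℝ α := by
  have hd' : (d : ℝ) ≠ 0 := by positivity
  rw [mem_doublyStochastic_iff_sum]
  refine ⟨fun x y => ?_, fun x => ?_, fun y => ?_⟩
  · unfold stepMatrix; split_ifs <;> positivity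
  · simp only [stepMatrix]
    rw [← sum_filter, sum_const, hR.out, nsmul_eq_mul, mul_inv_cancel₀ hd']
  · simp only [stepMatrix]
    rw [← sum_filter, sum_const, hR.inn, nsmul_eq_mul, mul_inv_cancel₀ hd']

lemma abs_pow_sub_le_of_minorized {P : Matrix α α ℝ} (hP : P ∈ doublyStochastic ℝ α) {c : ℝ}
    {m : ℕ} (h : ∀ x y, c / Fintype.card α ≤ (P ^ m) x y) (q : ℕ) (x y : α) :
    |(P ^ (m * q)) x y - 1 / Fintype.card α| ≤ (1 - c) ^ q := by
  have hn : (1 : ℝ) ≤ Fintype.card α := by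
    exact_mod_cast Fintype.card_pos_iff.2 ⟨x⟩
  induction q generalizing x with
  | zero =>
    have h1 : (1 : ℝ) / Fintype.card α ≤ 1 := by
      rw [div_le_one (by linarith)]; exact hn
    have h2 : (0 : ℝ) ≤ 1 / Fintype.card α := by positivity
    simp only [mul_zero, pow_zero, Matrix.one_apply]
    split_ifs <;> rw [abs_le] <;> constructor <;> linarith
  | succ q ih =>
    obtain ⟨-, hrow, -⟩ := mem_doublyStochastic_iff_sum.1 (pow_mem hP m)
    obtain ⟨-, -, hcol⟩ := mem_doublyStochastic_iff_sum.1 (pow_mem hP (m * q))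
    have e : (P ^ (m * (q + 1))) x y - 1 / Fintype.card α =
        ∑ z, ((P ^ m) x z - c / Fintype.card α) *
          ((P ^ (m * q)) z y - 1 / Fintype.card α) := by
      rw [mul_add, mul_one, add_comm, pow_add, Matrix.mul_apply]
      simp only [sub_mul, mul_sub, sum_sub_distrib, ← mul_sum, ← sum_mul, hrow, hcol]
      simp
      field_simp
      ring
    rw [e, pow_succ']
    refine (abs_sum_le_sum_abs _ _).trans ?_
    calc _ ≤ ∑ z, ((P ^ m) x z - c / Fintype.card α) * (1 - c) ^ q := by
          refine sum_le_sum fun z _ => ?_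
          rw [abs_mul, abs_of_nonneg (sub_nonneg.2 (h x z))]
          exact mul_le_mul_of_nonneg_left (ih z) (sub_nonneg.2 (h x z))
      _ = _ := by
          rw [← sum_mul, sum_sub_distrib, hrow]
          have : (Fintype.card α : ℝ) * (c / Fintype.card α) = c := by field_simp
          rw [sum_const, card_univ, nsmul_eq_mul, this]

lemma stepMatrix_pow_minorized {R : α → α → Prop} {d : ℕ} (hR : BiRegular R d) {δ ν : ℝ}
    (hδ : 0 < δ) (hν : 0 < ν) (hd : δ * Fintype.card α ≤ d)
    (hexp : ∀ S : Finset α, δ / 2 * Fintype.card α ≤ S.card →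
      (S.card : ℝ) ≤ (1 - δ / 2) * Fintype.card α →
      S.card + ν * Fintype.card α ≤
        ((univ.filter fun x => ν * Fintype.card α ≤
          ((univ.filter fun z => R x z ∧ z ∈ S).card : ℝ)).card : ℝ))
    {m : ℕ} (hm : 1 < δ + m * ν) (x y : α) :
    (min ν (1 / 2)) ^ m / Fintype.card α ≤ (stepMatrix R d ^ (m + 1)) x y := by
  set n : ℝ := (Fintype.card α : ℝ) with hn_def
  set κ : ℝ := min ν (1 / 2) with hκ
  have hκ0 : 0 < κ := lt_min hν (by norm_num)
  have hκ1 : κ ≤ ν := min_le_left _ _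
  have hκ2 : κ ≤ 1 / 2 := min_le_right _ _
  have hcard : ∀ S : Finset α, (S.card : ℝ) ≤ n := fun S => by
    rw [hn_def]; exact_mod_cast card_le_univ S
  have hn : (1 : ℝ) ≤ n := by simpa using hcard {x}
  have hd0 : (0 : ℝ) < d := lt_of_lt_of_le (by positivity) hd
  have hdn : (d : ℝ) ≤ n := by
    rw [← hR.out x]
    exact hcard _
  have hd1 : 1 ≤ d := by exact_mod_cast hd0
  set T : ℕ → Finset α := fun i => univ.filter fun x => κ ^ i / n ≤ (stepMatrix R d ^ (i + 1)) x y
    with hT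
  have low : ∀ i x, (d : ℝ)⁻¹ * (((univ.filter fun z => R x z ∧ z ∈ T i).card : ℝ) * (κ ^ i / n)) ≤
      (stepMatrix R d ^ (i + 2)) x y := by
    intro i x
    rw [pow_succ' _ (i + 1), stepMatrix_mul_apply]
    refine mul_le_mul_of_nonneg_left ?_ (by positivity)
    rw [← nsmul_eq_mul, ← filter_filter]
    refine (card_nsmul_le_sum _ _ _ fun z hz => ?_).trans
      (sum_le_sum_of_subset_of_nonneg (filter_subset _ _) fun z _ _ => ?_)
    · simp only [mem_filter, hT, mem_univ, true_and] at hz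
      exact hz.2
    · exact nonneg_of_mem_doublyStochastic (pow_mem (stepMatrix_mem_doublyStochastic hR hd1) _) 
  have key : ∀ i, T i = univ ∨ δ * n + i * (ν * n) ≤ ((T i).card : ℝ) := by
    intro i
    induction i with
    | zero =>
      right
      have : (univ.filter fun z => R z y) ⊆ T 0 := by
        intro z hz
        simp only [mem_filter, mem_univ, true_and, hT] at hz ⊢
        simp only [pow_zero, zero_add, pow_one, stepMatrix, hz, if_true]
        rw [one_div]
        exact inv_anti₀ hd0 hdn
      have h := card_le_card this
      rw [hR.inn] at h
      have h' : (d : ℝ) ≤ ((T 0).card : ℝ) := by exact_mod_cast h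
      push_cast
      linarith
    | succ i ih =>
      by_cases hbig : (1 - δ / 2) * n < ((T i).card : ℝ)
      · left
        rw [eq_univ_iff_forall]
        intro x
        simp only [hT, mem_filter, mem_univ, true_and]
        refine le_trans ?_ (low i x)
        have h1 : (d : ℝ) / 2 ≤ ((univ.filter fun z => R x z ∧ z ∈ T i).card : ℝ) := by
          have h2 : (univ.filter fun z => R x z).card ≤
              (univ.filter fun z => R x z ∧ z ∈ T i).card + ((T i)ᶜ).card := by
            refine (card_le_card fun z hz => ?_).trans (card_union_le _ _)
            simp only [mem_filter, mem_univ, true_and, mem_union, mem_compl] at hz ⊢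
            tauto
          rw [hR.out] at h2
          have h3 := card_compl_add_card (T i)
          have h2' : (d : ℝ) ≤ ((univ.filter fun z => R x z ∧ z ∈ T i).card : ℝ) +
            (((T i)ᶜ).card : ℝ) := by exact_mod_cast h2
          have h3' : (((T i)ᶜ).card : ℝ) + ((T i).card : ℝ) = n := by
            rw [hn_def]; exact_mod_cast h3
          nlinarith
        calc κ ^ (i + 1) / n = κ * (κ ^ i / n) := by ring
          _ ≤ 1 / 2 * (κ ^ i / n) := mul_le_mul_of_nonneg_right hκ2 (by positivity)
          _ = (d : ℝ)⁻¹ * (d / 2 * (κ ^ i / n)) := by field_simp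
          _ ≤ _ := by gcongr
      · push Not at hbig
        have hsmall : δ / 2 * n ≤ ((T i).card : ℝ) := by
          rcases ih with ih | ih
          · rw [ih, card_univ] at hbig
            change n ≤ _ at hbig
            nlinarith
          · have : (0 : ℝ) ≤ i * (ν * n) := by positivity
            nlinarith
        have hex := hexp (T i) hsmall hbig
        right
        have hsub : (univ.filter fun x => ν * n ≤
          ((univ.filter fun z => R x z ∧ z ∈ T i).card : ℝ)) ⊆ T (i + 1) := by
          intro x hx
          replace hx := (mem_filter.1 hx).2
          refine mem_filter.2 ⟨mem_univ _, le_trans ?_ (low i x)⟩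
          calc κ ^ (i + 1) / n = κ * (κ ^ i / n) := by ring
            _ ≤ ν * (κ ^ i / n) := mul_le_mul_of_nonneg_right hκ1 (by positivity)
            _ = (d : ℝ)⁻¹ * (ν * d * (κ ^ i / n)) := by field_simp
            _ ≤ (d : ℝ)⁻¹ * (ν * n * (κ ^ i / n)) := by gcongr
            _ ≤ _ := by gcongr
        have h4 := card_le_card hsub
        have h4' : ((univ.filter fun x => ν * n ≤
          ((univ.filter fun z => R x z ∧ z ∈ T i).card : ℝ)).card : ℝ) ≤ ((T (i + 1)).card : ℝ) := by
          exact_mod_cast h4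
        have h5 : δ * n + i * (ν * n) ≤ ((T i).card : ℝ) := by
          rcases ih with ih | ih
          · rw [ih, card_univ] at hbig
            change n ≤ _ at hbig
            nlinarith
          · exact ih
        push_cast
        linarith
  have hx : x ∈ T m := by
    rcases key m with h | h
    · rw [h]; exact mem_univ x
    · have h1 : ((T m).card : ℝ) ≤ n := hcard _
      nlinarith
  simp only [hT, mem_filter, mem_univ, true_and] at hx
  exact hx

end Mixing

section Switching

open scoped Classical

variable {α : Type*} [DecidableEq α]

lemma isChain_iff_formPerm {R : α → α → Prop} {l : List α} {a : α} (hl : l.Nodup)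
    (ha : l.getLast? = some a) : l.IsChain R ↔ ∀ x ∈ l, x ≠ a → R x (l.formPerm x) := by
  have hne : l ≠ [] := by rintro rfl; simp at ha
  have hla : l[l.length - 1]'(by have := List.length_pos_of_ne_nil hne; omega) = a := by
    rw [List.getLast?_eq_getElem?, List.getElem?_eq_some_iff] at ha
    exact ha.2
  rw [List.isChain_iff_getElem]
  constructor
  · intro h x hx hxa
    obtain ⟨i, hi, rfl⟩ := List.mem_iff_getElem.1 hx
    have : i + 1 < l.length := by
      by_contra hcon
      have : i = l.length - 1 := by omega
      subst this
      exact hxa hla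
    rw [List.formPerm_apply_lt_getElem l hl i this]
    exact h i this
  · intro h i hi
    rw [← List.formPerm_apply_lt_getElem l hl i hi]
    refine h _ (List.getElem_mem _) ?_
    rw [← hla]
    intro heq
    have := (hl.getElem_inj_iff).1 heq
    omega

lemma formPerm_getLast_eq_head {l : List α} {a z : α} (ha : l.getLast? = some a)
    (hz : l.head? = some z) : l.formPerm a = z := by
  rcases l with _ | ⟨u, l⟩
  · simp at ha
  · simp at hz
    subst hz
    have : (u :: l).getLast (by simp) = a := by
      rw [List.getLast?_eq_getLast_of_ne_nil (by simp)] at ha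
      exact Option.some_injective _ ha
    rw [← this]
    exact List.formPerm_apply_getLast _ _

variable [Fintype α]

/-- The perfect matchings `x ↦ σ x` of the bipartite graph `E`, as permutations. -/
noncomputable def matchings (E : α → α → Prop) : Finset (Equiv.Perm α) :=
  univ.filter fun σ => ∀ x, E x (σ x)

lemma mem_matchings {E : α → α → Prop} {σ : Equiv.Perm α} :
    σ ∈ matchings E ↔ ∀ x, E x (σ x) := by
  simp [matchings]

/-- The digraph whose directed cycles are the alternating cycles of `σ`. -/
def altDigraph (E : α → α → Prop) (σ : Equiv.Perm α) : α → α → Prop := fun x y => E y (σ x)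

/-- The reversal of `altDigraph E σ`. -/
def altDigraph' (E : α → α → Prop) (σ : Equiv.Perm α) : α → α → Prop := fun x y => E x (σ y)

/-- Alternating cycles of length `k + 1` through the matching edge of `σ` at `a`. -/
noncomputable def closedCycles (E : α → α → Prop) (k : ℕ) (a : α) (σ : Equiv.Perm α) :
    Finset (List α) :=
  (univ.filter fun z => altDigraph E σ a z).biUnion fun z =>
    (walks (altDigraph E σ) k z a).filter List.Nodup

/-- Alternating cycles of length `k + 1` through the non-matching edge `ab`. -/
noncomputable def openCycles (E : α → α → Prop) (k : ℕ) (a b : α) (σ : Equiv.Perm α) :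
    Finset (List α) :=
  (walks (altDigraph' E σ) k (σ.symm b) a).filter List.Nodup

lemma mem_closedCycles {E : α → α → Prop} {k : ℕ} {a : α} {σ : Equiv.Perm α} {l : List α} :
    l ∈ closedCycles E k a σ ↔ ∃ z, altDigraph E σ a z ∧ l ∈ walks (altDigraph E σ) k z a ∧
      l.Nodup := by
  simp [closedCycles]

lemma switch_closed {E : α → α → Prop} {k : ℕ} (hk : 1 ≤ k) {a b : α} {σ : Equiv.Perm α}
    {l : List α} (hσ : σ ∈ matchings E) (hab : σ a = b) (hl : l ∈ closedCycles E k a σ) :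
    σ * l.formPerm⁻¹ ∈ matchings E ∧ (σ * l.formPerm⁻¹) a ≠ b ∧
      l ∈ openCycles E k a b (σ * l.formPerm⁻¹) := by
  obtain ⟨z, hz, hw, hnd⟩ := mem_closedCycles.1 hl
  have hza := ne_of_mem_walks_of_nodup hk hw hnd
  obtain ⟨h1, h2, h3, h4⟩ := mem_walks.1 hw
  have hτ := formPerm_getLast_eq_head h3 h2
  rw [mem_matchings] at hσ
  rw [isChain_iff_formPerm hnd h3] at h4
  have hσ' : ∀ x, (σ * l.formPerm⁻¹) (l.formPerm x) = σ x := fun x => by simp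
  refine ⟨mem_matchings.2 fun y => ?_, fun h => ?_, ?_⟩
  · obtain ⟨x, rfl⟩ := l.formPerm.surjective y
    rw [hσ']
    by_cases hx : x ∈ l
    · by_cases hxa : x = a
      · subst hxa; rw [hτ]; exact hz
      · exact h4 x hx hxa
    · rw [List.formPerm_apply_of_notMem hx]; exact hσ x
  · rw [← hab, ← hσ' a] at h
    have := (σ * l.formPerm⁻¹).injective h
    rw [hτ] at this
    exact hza this.symm
  · rw [openCycles, mem_filter, mem_walks]
    refine ⟨⟨h1, ?_, h3, ?_⟩, hnd⟩
    · rw [h2, ← hab, ← hσ' a, Equiv.symm_apply_apply, hτ]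
    · rw [isChain_iff_formPerm hnd h3]
      intro x hx hxa
      change E x _
      rw [hσ']
      exact hσ x

lemma switch_open {E : α → α → Prop} {k : ℕ} {a b : α} (hE : E a b)
    {σ : Equiv.Perm α} {l : List α} (hσ : σ ∈ matchings E)
    (hl : l ∈ openCycles E k a b σ) :
    σ * l.formPerm ∈ matchings E ∧ (σ * l.formPerm) a = b ∧
      l ∈ closedCycles E k a (σ * l.formPerm) := by
  rw [openCycles, mem_filter] at hl
  obtain ⟨hw, hnd⟩ := hl
  obtain ⟨h1, h2, h3, h4⟩ := mem_walks.1 hw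
  have hτ := formPerm_getLast_eq_head h3 h2
  rw [mem_matchings] at hσ
  rw [isChain_iff_formPerm hnd h3] at h4
  have hab : (σ * l.formPerm) a = b := by simp [hτ]
  refine ⟨mem_matchings.2 fun x => ?_, hab, mem_closedCycles.2 ⟨σ.symm b, ?_, ?_, hnd⟩⟩
  · by_cases hx : x ∈ l
    · by_cases hxa : x = a
      · subst hxa; rw [hab]; exact hE
      · exact h4 x hx hxa
    · rw [Equiv.Perm.mul_apply, List.formPerm_apply_of_notMem hx]; exact hσ x
  · change E _ _
    rw [hab]
    simpa using hσ (σ.symm b)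
  · rw [mem_walks]
    refine ⟨h1, h2, h3, ?_⟩
    rw [isChain_iff_formPerm hnd h3]
    intro x hx hxa
    exact hσ _

lemma sum_closed_eq_sum_open {E : α → α → Prop} {k : ℕ} (hk : 1 ≤ k) {a b : α} (hE : E a b)
    (F : Equiv.Perm α → List α → ℝ) :
    ∑ σ ∈ matchings E with σ a = b, ∑ l ∈ closedCycles E k a σ, F (σ * l.formPerm⁻¹) l =
      ∑ σ ∈ matchings E with σ a ≠ b, ∑ l ∈ openCycles E k a b σ, F σ l := by
  rw [sum_sigma', sum_sigma']
  refine sum_bij' (fun p _ => ⟨p.1 * p.2.formPerm⁻¹, p.2⟩) (fun p _ => ⟨p.1 * p.2.formPerm, p.2⟩)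
    ?_ ?_ ?_ ?_ ?_
  · rintro ⟨σ, l⟩ h
    simp only [mem_sigma, mem_filter] at h ⊢
    obtain ⟨h1, h2, h3⟩ := switch_closed hk h.1.1 h.1.2 h.2
    exact ⟨⟨h1, h2⟩, h3⟩
  · rintro ⟨σ, l⟩ h
    simp only [mem_sigma, mem_filter] at h ⊢
    obtain ⟨h1, h2, h3⟩ := switch_open hE h.1.1 h.2
    exact ⟨⟨h1, h2⟩, h3⟩
  · rintro ⟨σ, l⟩ _
    simp
  · rintro ⟨σ, l⟩ _
    simp
  · rintro ⟨σ, l⟩ _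
    simp

/-- The number of edges of `N` in the matching `σ`. -/
noncomputable def hits (N : Finset (α × α)) (σ : Equiv.Perm α) : ℕ :=
  (univ.filter fun x => (x, σ x) ∈ N).card

lemma hits_eq_of_good {E : α → α → Prop} {k : ℕ} (hk : 1 ≤ k) {a b : α} {σ : Equiv.Perm α}
    {l : List α} {N : Finset (α × α)} (hN : (a, b) ∈ N) (hab : σ a = b)
    (hl : l ∈ closedCycles E k a σ)
    (h₁ : l.IsChain fun x y => (y, σ x) ∉ N) (h₂ : ∀ z ∈ l.head?, (z, b) ∉ N)
    (h₃ : l.IsChain fun x y => (x, (σ * l.formPerm⁻¹) y) ∉ N) :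
    hits N σ = hits N (σ * l.formPerm⁻¹) + 1 := by
  obtain ⟨z, hz, hw, hnd⟩ := mem_closedCycles.1 hl
  have hza := ne_of_mem_walks_of_nodup hk hw hnd
  have hal := last_mem_of_mem_walks hw
  obtain ⟨-, h2, h3, -⟩ := mem_walks.1 hw
  have hτ := formPerm_getLast_eq_head h3 h2
  have hσ' : ∀ x, (σ * l.formPerm⁻¹) (l.formPerm x) = σ x := fun x => by simp
  rw [isChain_iff_formPerm hnd h3] at h₁ h₃
  simp only [hσ'] at h₃
  have hnew : ∀ x ∈ l, (l.formPerm x, σ x) ∉ N := by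
    intro x hx
    by_cases hxa : x = a
    · subst hxa
      rw [hτ, hab]
      exact h₂ z h2
    · exact h₁ x hx hxa
  have hnew' : ∀ y ∈ l, (y, (σ * l.formPerm⁻¹) y) ∉ N := by
    intro y hy
    obtain ⟨x, rfl⟩ := l.formPerm.surjective y
    rw [hσ']
    exact hnew x ((List.formPerm_mem_iff_mem).1 hy)
  have hout : ∀ y, y ∉ l → (σ * l.formPerm⁻¹) y = σ y := by
    intro y hy
    conv_lhs => rw [← List.formPerm_apply_of_notMem hy]
    rw [hσ']
  unfold hits
  rw [← card_insert_of_notMem (a := a) (by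
    rw [mem_filter]; exact fun h => hnew' a hal h.2)]
  congr 1
  ext y
  simp only [mem_filter, mem_univ, true_and, mem_insert]
  by_cases hy : y ∈ l
  · by_cases hya : y = a
    · subst hya; simp [hab, hN]
    · simp only [hya, false_or, hnew' y hy, iff_false]
      exact h₃ y hy hya
  · rw [hout y hy]
    have : y ≠ a := fun h => hy (h ▸ hal)
    simp [this]

end Switching

section SwitchingInequality

open scoped Classical

variable {α : Type*} [Fintype α]

/-- The number of paths of length `k` between distinct vertices of `R` is about `T`, and few
walks of length `k` use a step from a set of bad steps of maximum degree `r`. -/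
structure PathBounds (R : α → α → Prop) (k r : ℕ) (T η θ : ℝ) : Prop where
  nodup : ∀ z a, z ≠ a → |walkCount R k z a List.Nodup - T| ≤ T * η
  bad : ∀ S : α → α → Prop, (∀ x, (univ.filter fun z => R x z ∧ ¬ S x z).card ≤ r) →
    (∀ y, (univ.filter fun z => R z y ∧ ¬ S z y).card ≤ r) →
    ∀ x y, walkCount R k x y (fun l => ¬ l.IsChain S) ≤ T * θ

variable [DecidableEq α]

lemma card_filter_closedCycles (E : α → α → Prop) {k : ℕ} (hk : 1 ≤ k) (a : α)
    (σ : Equiv.Perm α) (Q : List α → Prop) [DecidablePred Q] :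
    (((closedCycles E k a σ).filter Q).card : ℝ) =
      ∑ z ∈ (univ.filter fun z => altDigraph E σ a z).erase a,
        walkCount (altDigraph E σ) k z a (fun l => l.Nodup ∧ Q l) := by
  rw [sum_erase]
  · rw [closedCycles, filter_biUnion, card_biUnion, Nat.cast_sum]
    · refine sum_congr rfl fun z _ => ?_
      rw [filter_filter, walkCount]
      congr!
    · intro z _ z' _ hzz
      rw [Function.onFun, disjoint_left]
      intro l hl hl'
      simp only [mem_filter] at hl hl'
      have h1 := (mem_walks.1 hl.1.1).2.1
      have h2 := (mem_walks.1 hl'.1.1).2.1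
      rw [h1] at h2
      exact hzz (by simpa using h2)
  · exact walkCount_eq_zero fun l hl h => ne_of_mem_walks_of_nodup hk hl h.1 rfl

lemma card_out_erase {E : α → α → Prop} {d : ℕ} {σ : Equiv.Perm α} (hσ : σ ∈ matchings E)
    (hR : BiRegular (altDigraph E σ) d) (hd : 1 ≤ d) (a : α) :
    ((((univ.filter fun z => altDigraph E σ a z).erase a).card : ℕ) : ℝ) = d - 1 := by
  rw [card_erase_of_mem, hR.out, Nat.cast_sub hd, Nat.cast_one]
  rw [mem_filter]
  exact ⟨mem_univ a, mem_matchings.1 hσ a⟩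

lemma abs_card_closedCycles_sub_le {E : α → α → Prop} {k r d : ℕ} (hk : 1 ≤ k) (hd : 1 ≤ d)
    {T η θ : ℝ} {σ : Equiv.Perm α} (hσ : σ ∈ matchings E)
    (hR : BiRegular (altDigraph E σ) d) (hP : PathBounds (altDigraph E σ) k r T η θ) (a : α) :
    |((closedCycles E k a σ).card : ℝ) - (d - 1) * T| ≤ (d - 1) * (T * η) := by
  have h := card_filter_closedCycles E hk a σ (fun _ => True)
  rw [filter_true] at h
  rw [h, ← card_out_erase hσ hR hd a, ← nsmul_eq_mul, ← nsmul_eq_mul, ← sum_const, ← sum_const,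
    ← sum_sub_distrib]
  refine (abs_sum_le_sum_abs _ _).trans (sum_le_sum fun z hz => ?_)
  simpa using hP.nodup z a (ne_of_mem_erase hz)

lemma card_bad_closedCycles_le {E : α → α → Prop} {k r d : ℕ} (hk : 1 ≤ k) (hd : 1 ≤ d)
    {T η θ : ℝ} (hT : 0 ≤ T) (hη : 0 ≤ η) {σ : Equiv.Perm α} (hσ : σ ∈ matchings E)
    (hR : BiRegular (altDigraph E σ) d) (hP : PathBounds (altDigraph E σ) k r T η θ)
    {N : Finset (α × α)} (hN₁ : ∀ x, (univ.filter fun y => (x, y) ∈ N).card ≤ r)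
    (hN₂ : ∀ y, (univ.filter fun x => (x, y) ∈ N).card ≤ r) (a b : α) :
    (((closedCycles E k a σ).filter fun l => ¬ l.IsChain (fun x y => (y, σ x) ∉ N) ∨
      ∃ z ∈ l.head?, (z, b) ∈ N).card : ℝ) ≤ (d - 1) * (T * θ) + r * (T * (1 + η)) := by
  rw [card_filter_closedCycles E hk]
  have hbad := hP.bad (fun x y => (y, σ x) ∉ N)
    (fun x => by
      refine le_trans (card_le_card fun z hz => ?_) (hN₂ (σ x))
      simp at hz ⊢
      exact hz.2)
    (fun y => by
      refine le_trans ?_ (hN₁ y)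
      refine card_le_card_of_injOn σ (fun x hx => ?_) σ.injective.injOn
      simp at hx ⊢
      exact hx.2)
  calc _ ≤ ∑ z ∈ (univ.filter fun z => altDigraph E σ a z).erase a,
        (T * θ + if (z, b) ∈ N then T * (1 + η) else 0) := by
        refine sum_le_sum fun z hz => ?_
        have hza := ne_of_mem_erase hz
        split_ifs with hzb
        · refine (walkCount_le_add (Q₁ := fun l => ¬ l.IsChain fun x y => (y, σ x) ∉ N)
            (Q₂ := List.Nodup) fun l _ h => Or.inr h.1).trans (add_le_add (hbad z a) ?_)
          have := (abs_le.1 (hP.nodup z a hza)).2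
          linarith
        · rw [add_zero]
          refine (walkCount_mono fun l hl h => ?_).trans (hbad z a)
          rcases h.2 with h | ⟨z', hz', h⟩
          · exact h
          · rw [(mem_walks.1 hl).2.1] at hz'
            obtain rfl : z = z' := by simpa using hz'
            exact absurd h hzb
    _ ≤ (d - 1) * (T * θ) + ∑ z, (if (z, b) ∈ N then T * (1 + η) else 0) := by
        rw [sum_add_distrib, sum_const, nsmul_eq_mul, card_out_erase hσ hR hd]
        refine add_le_add le_rfl (sum_le_sum_of_subset_of_nonneg (subset_univ _) fun _ _ _ => ?_)
        split_ifs <;> positivity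
    _ ≤ _ := by
        rw [← sum_filter, sum_const, nsmul_eq_mul]
        have : ((univ.filter fun x => (x, b) ∈ N).card : ℝ) ≤ r := by exact_mod_cast hN₂ b
        gcongr

lemma card_filter_openCycles (E : α → α → Prop) (k : ℕ) (a b : α) (σ : Equiv.Perm α)
    (Q : List α → Prop) [DecidablePred Q] :
    (((openCycles E k a b σ).filter Q).card : ℝ) =
      walkCount (altDigraph' E σ) k (σ.symm b) a (fun l => l.Nodup ∧ Q l) := by
  rw [openCycles, filter_filter, walkCount]
  congr!

lemma abs_card_openCycles_sub_le {E : α → α → Prop} {k r : ℕ} {T η θ : ℝ} {σ : Equiv.Perm α}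
    (hP : PathBounds (altDigraph' E σ) k r T η θ) {a b : α} (hab : σ a ≠ b) :
    |((openCycles E k a b σ).card : ℝ) - T| ≤ T * η := by
  have h := card_filter_openCycles E k a b σ (fun _ => True)
  rw [filter_true] at h
  rw [h]
  simpa using hP.nodup (σ.symm b) a fun h => hab (by rw [← h]; simp)

lemma card_bad_openCycles_le {E : α → α → Prop} {k r : ℕ} {T η θ : ℝ} {σ : Equiv.Perm α}
    (hP : PathBounds (altDigraph' E σ) k r T η θ)
    {N : Finset (α × α)} (hN₁ : ∀ x, (univ.filter fun y => (x, y) ∈ N).card ≤ r)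
    (hN₂ : ∀ y, (univ.filter fun x => (x, y) ∈ N).card ≤ r) (a b : α) :
    (((openCycles E k a b σ).filter fun l => ¬ l.IsChain (fun x y => (x, σ y) ∉ N)).card : ℝ) ≤
      T * θ := by
  refine le_trans ?_ (hP.bad (fun x y => (x, σ y) ∉ N) (fun x => ?_) (fun y => ?_) (σ.symm b) a)
  · rw [card_filter_openCycles]
    exact walkCount_mono fun l _ h => h.2
  · refine le_trans ?_ (hN₁ x)
    refine card_le_card_of_injOn σ (fun z hz => ?_) σ.injective.injOn
    simp at hz ⊢
    exact hz.2
  · refine le_trans (card_le_card fun z hz => ?_) (hN₂ (σ y))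
    simp at hz ⊢
    exact hz.2

lemma abs_sum_card_mul_sub_le {ι : Type*} (s : Finset ι) (c g : ι → ℝ) {C e G : ℝ}
    (hc : ∀ i ∈ s, |c i - C| ≤ e) (hg : ∀ i, |g i| ≤ G) :
    |∑ i ∈ s, c i * g i - C * ∑ i ∈ s, g i| ≤ s.card * (e * G) := by
  rw [mul_sum, ← sum_sub_distrib, ← nsmul_eq_mul, ← sum_const]
  refine (abs_sum_le_sum_abs _ _).trans (sum_le_sum fun i hi => ?_)
  rw [← sub_mul, abs_mul]
  exact mul_le_mul (hc i hi) (hg i) (abs_nonneg _) ((abs_nonneg _).trans (hc i hi))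

/-- Double counting of the pairs of matchings that differ in one alternating cycle
through the edge `ab`. -/
lemma switching_inequality {E : α → α → Prop} {k r d : ℕ} (hk : 1 ≤ k) (hd : 1 ≤ d)
    {T η θ : ℝ} (hT : 0 < T) (hη : 0 ≤ η)
    (hR : ∀ σ ∈ matchings E, BiRegular (altDigraph E σ) d)
    (hP : ∀ σ ∈ matchings E, PathBounds (altDigraph E σ) k r T η θ)
    (hP' : ∀ σ ∈ matchings E, PathBounds (altDigraph' E σ) k r T η θ)
    {N : Finset (α × α)} (hN₁ : ∀ x, (univ.filter fun y => (x, y) ∈ N).card ≤ r)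
    (hN₂ : ∀ y, (univ.filter fun x => (x, y) ∈ N).card ≤ r) {a b : α} (hE : E a b)
    (hN : (a, b) ∈ N) (g : ℕ → ℝ) {G : ℝ} (hg : ∀ i, |g i| ≤ G) :
    |(d - 1) * ∑ σ ∈ matchings E with σ a = b, g (hits N σ) -
      ∑ σ ∈ matchings E with σ a ≠ b, g (hits N σ + 1)| ≤
    G * ((η + 2 * θ) * ((d - 1) * ((matchings E).filter fun σ => σ a = b).card +
      ((matchings E).filter fun σ => σ a ≠ b).card) +
      2 * r * (1 + η) * ((matchings E).filter fun σ => σ a = b).card) := by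
  have hG : 0 ≤ G := (abs_nonneg _).trans (hg 0)
  set s := (matchings E).filter fun σ => σ a = b with hs
  set s' := (matchings E).filter fun σ => σ a ≠ b with hs'
  have h1 := abs_sum_card_mul_sub_le s (fun σ => ((closedCycles E k a σ).card : ℝ))
    (fun σ => g (hits N σ)) (fun σ hσ => by
      have hσ := (mem_filter.1 hσ).1
      exact abs_card_closedCycles_sub_le hk hd hσ (hR σ hσ) (hP σ hσ) a) (fun σ => hg _)
  have h2 := abs_sum_card_mul_sub_le s' (fun σ => ((openCycles E k a b σ).card : ℝ))
    (fun σ => g (hits N σ + 1)) (fun σ hσ => by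
      have hσ := mem_filter.1 hσ
      exact abs_card_openCycles_sub_le (hP' σ hσ.1) hσ.2) (fun σ => hg _)
  set B₁ : Equiv.Perm α → List α → Prop := fun σ l =>
    ¬ l.IsChain (fun x y => (y, σ x) ∉ N) ∨ ∃ z ∈ l.head?, (z, b) ∈ N with hB₁
  set B₂ : Equiv.Perm α → List α → Prop := fun σ l =>
    ¬ l.IsChain (fun x y => (x, σ y) ∉ N) with hB₂
  have h3 : |∑ σ ∈ s, ((closedCycles E k a σ).card : ℝ) * g (hits N σ) -
      ∑ σ ∈ s', ((openCycles E k a b σ).card : ℝ) * g (hits N σ + 1)| ≤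
      2 * G * (s.card * ((d - 1) * (T * θ) + r * (T * (1 + η))) + s'.card * (T * θ)) := by
    have e1 : ∑ σ ∈ s', ((openCycles E k a b σ).card : ℝ) * g (hits N σ + 1) =
        ∑ σ ∈ s, ∑ l ∈ closedCycles E k a σ, g (hits N (σ * l.formPerm⁻¹) + 1) := by
      rw [sum_closed_eq_sum_open hk hE (fun σ _ => g (hits N σ + 1))]
      simp [hs']
    have e2 : ∑ σ ∈ s, ((closedCycles E k a σ).card : ℝ) * g (hits N σ) =
        ∑ σ ∈ s, ∑ l ∈ closedCycles E k a σ, g (hits N σ) := by simp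
    have b1 : ∑ σ ∈ s, ∑ l ∈ closedCycles E k a σ, (if B₁ σ l then (1 : ℝ) else 0) ≤
        s.card * ((d - 1) * (T * θ) + r * (T * (1 + η))) := by
      rw [← nsmul_eq_mul]
      refine sum_le_card_nsmul _ _ _ fun σ hσ => ?_
      rw [sum_boole]
      have hσ := (mem_filter.1 hσ).1
      exact card_bad_closedCycles_le hk hd hT.le hη hσ (hR σ hσ) (hP σ hσ) hN₁ hN₂ a b
    have b2 : ∑ σ ∈ s, ∑ l ∈ closedCycles E k a σ,
        (if B₂ (σ * l.formPerm⁻¹) l then (1 : ℝ) else 0) ≤ s'.card * (T * θ) := by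
      rw [sum_closed_eq_sum_open hk hE (fun σ l => if B₂ σ l then (1 : ℝ) else 0),
        ← nsmul_eq_mul]
      refine sum_le_card_nsmul _ _ _ fun σ hσ => ?_
      rw [sum_boole]
      exact card_bad_openCycles_le (hP' σ (mem_filter.1 hσ).1) hN₁ hN₂ a b
    rw [e1, e2, ← sum_sub_distrib]
    simp only [← sum_sub_distrib]
    calc _ ≤ ∑ σ ∈ s, ∑ l ∈ closedCycles E k a σ,
          |g (hits N σ) - g (hits N (σ * l.formPerm⁻¹) + 1)| :=
          (abs_sum_le_sum_abs _ _).trans (sum_le_sum fun σ _ => abs_sum_le_sum_abs _ _)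
      _ ≤ ∑ σ ∈ s, ∑ l ∈ closedCycles E k a σ, 2 * G * ((if B₁ σ l then (1 : ℝ) else 0) +
          (if B₂ (σ * l.formPerm⁻¹) l then (1 : ℝ) else 0)) := by
          refine sum_le_sum fun σ hσ => sum_le_sum fun l hl => ?_
          have hle : |g (hits N σ) - g (hits N (σ * l.formPerm⁻¹) + 1)| ≤ 2 * G := by
            have := hg (hits N σ)
            have := hg (hits N (σ * l.formPerm⁻¹) + 1)
            refine (abs_sub _ _).trans ?_
            linarith
          by_cases hb₁ : B₁ σ l
          · rw [if_pos hb₁]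
            split_ifs <;> linarith
          · by_cases hb₂ : B₂ (σ * l.formPerm⁻¹) l
            · rw [if_neg hb₁, if_pos hb₂]
              linarith
            · simp only [hB₁, hB₂, not_or, not_not, not_exists, not_and] at hb₁ hb₂
              rw [hits_eq_of_good hk hN (mem_filter.1 hσ).2 hl hb₁.1 hb₁.2 hb₂, sub_self, abs_zero]
              positivity
      _ ≤ _ := by
          simp only [← mul_sum, sum_add_distrib]
          exact mul_le_mul_of_nonneg_left (add_le_add b1 b2) (by positivity)
  rw [abs_le] at h1 h2 h3
  have key : T * |(d - 1) * ∑ σ ∈ s, g (hits N σ) - ∑ σ ∈ s', g (hits N σ + 1)| ≤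
      T * (G * ((η + 2 * θ) * ((d - 1) * s.card + s'.card) + 2 * r * (1 + η) * s.card)) := by
    rw [← abs_of_pos hT, ← abs_mul, abs_of_pos hT, abs_le]
    constructor <;> linarith
  exact le_of_mul_le_mul_left key hT

end SwitchingInequality

section PathBounds

open scoped Classical

variable {α : Type*} [Fintype α]

lemma pathBounds_of_abs_pow_sub_le {R : α → α → Prop} {d : ℕ} (hR : BiRegular R d) (hd : 1 ≤ d)
    {k : ℕ} (hk : 2 ≤ k) {ρ : ℝ}
    (hρ : ∀ x y, |(stepMatrix R d ^ k) x y - 1 / Fintype.card α| ≤ ρ) (r : ℕ) :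
    PathBounds R k r ((d : ℝ) ^ k / Fintype.card α)
      (Fintype.card α * ρ + ((k : ℝ) + 1) ^ 2 * Fintype.card α / (d : ℝ) ^ 2)
      (k * r * Fintype.card α / (d : ℝ) ^ 2) := by
  have hd' : (0 : ℝ) < d := by exact_mod_cast hd
  constructor
  · intro z a hza
    have hn : (0 : ℝ) < Fintype.card α := by exact_mod_cast Fintype.card_pos_iff.2 ⟨z⟩
    have h1 := walkCount_eq_stepMatrix_pow R hd k z a
    have h2 := walkCount_not_nodup_le hR hd k hza
    have h3 := walkCount_le_add (R := R) (k := k) (x := z) (y := a) (Q := fun _ => True)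
      (Q₁ := List.Nodup) (Q₂ := fun l => ¬ l.Nodup) fun l _ _ => em _
    have h4 := walkCount_mono (R := R) (k := k) (x := z) (y := a) (Q := List.Nodup)
      (Q' := fun _ => True) fun _ _ _ => trivial
    have h5 : |(d : ℝ) ^ k * (stepMatrix R d ^ k) z a - (d : ℝ) ^ k / Fintype.card α| ≤
        (d : ℝ) ^ k * ρ := by
      rw [div_eq_mul_one_div, ← mul_sub, abs_mul, abs_of_pos (by positivity : (0 : ℝ) < d ^ k)]
      exact mul_le_mul_of_nonneg_left (hρ z a) (by positivity)
    have e : (d : ℝ) ^ k / Fintype.card α * (Fintype.card α * ρ +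
        ((k : ℝ) + 1) ^ 2 * Fintype.card α / (d : ℝ) ^ 2) =
        (d : ℝ) ^ k * ρ + ((k : ℝ) + 1) ^ 2 * (d : ℝ) ^ k / (d : ℝ) ^ 2 := by
      field_simp
    rw [e]
    rw [abs_le] at h5 ⊢
    have h6 : 0 ≤ ((k : ℝ) + 1) ^ 2 * (d : ℝ) ^ k / (d : ℝ) ^ 2 := by positivity
    constructor <;> linarith
  · intro S hout hin x y
    have hn : (0 : ℝ) < Fintype.card α := by exact_mod_cast Fintype.card_pos_iff.2 ⟨x⟩
    obtain ⟨k, rfl⟩ := Nat.exists_eq_add_of_le' hk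
    refine (walkCount_bad_le hR hd hout hin k x y).trans (le_of_eq ?_)
    push_cast
    field_simp
    ring

variable {E : α → α → Prop} {d : ℕ}

lemma BiRegular.altDigraph (hE : BiRegular E d) (σ : Equiv.Perm α) :
    BiRegular (altDigraph E σ) d := by
  refine ⟨fun x => hE.inn (σ x), fun y => ?_⟩
  rw [← hE.out y]
  exact card_equiv σ fun z => by
    simp only [mem_filter, mem_univ, true_and]
    exact Iff.rfl

lemma abs_stepMatrix_altDigraph_pow_sub_le (hE : BiRegular E d) (hd1 : 1 ≤ d) {δ ν : ℝ}
    (hδ : 0 < δ) (hν : 0 < ν) (hd : δ * Fintype.card α ≤ d)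
    (hexp : ∀ S : Finset α, δ / 2 * Fintype.card α ≤ S.card →
      (S.card : ℝ) ≤ (1 - δ / 2) * Fintype.card α →
      S.card + ν * Fintype.card α ≤
        ((univ.filter fun y => ν * Fintype.card α ≤
          ((univ.filter fun z => E z y ∧ z ∈ S).card : ℝ)).card : ℝ))
    {m : ℕ} (hm : 1 < δ + m * ν) (q : ℕ) (σ : Equiv.Perm α) (x y : α) :
    |(stepMatrix (altDigraph E σ) d ^ ((m + 1) * q)) x y - 1 / Fintype.card α| ≤
      (1 - (min ν (1 / 2)) ^ m) ^ q := by
  refine abs_pow_sub_le_of_minorized (stepMatrix_mem_doublyStochastic (hE.altDigraph σ) hd1)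
    (fun x y => stepMatrix_pow_minorized (hE.altDigraph σ) hδ hν hd (fun S h1 h2 => ?_) hm x y)
    q x y
  refine (hexp S h1 h2).trans (le_of_eq ?_)
  exact_mod_cast (card_equiv σ fun z => by
    simp only [mem_filter, mem_univ, true_and]
    exact Iff.rfl).symm

lemma pathBounds_altDigraph (hE : BiRegular E d) (hd1 : 1 ≤ d) {δ ν : ℝ}
    (hδ : 0 < δ) (hν : 0 < ν) (hd : δ * Fintype.card α ≤ d)
    (hexp : ∀ S : Finset α, δ / 2 * Fintype.card α ≤ S.card →
      (S.card : ℝ) ≤ (1 - δ / 2) * Fintype.card α →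
      S.card + ν * Fintype.card α ≤
        ((univ.filter fun y => ν * Fintype.card α ≤
          ((univ.filter fun z => E z y ∧ z ∈ S).card : ℝ)).card : ℝ))
    {m : ℕ} (hm : 1 < δ + m * ν) {k q : ℕ} (hk : k = (m + 1) * q) (hk2 : 2 ≤ k) (r : ℕ)
    {η θ : ℝ} (hη : η = Fintype.card α * (1 - (min ν (1 / 2)) ^ m) ^ q +
      ((k : ℝ) + 1) ^ 2 * Fintype.card α / (d : ℝ) ^ 2)
    (hθ : θ = k * r * Fintype.card α / (d : ℝ) ^ 2) (σ : Equiv.Perm α) :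
    PathBounds (altDigraph E σ) k r ((d : ℝ) ^ k / Fintype.card α) η θ ∧
    PathBounds (altDigraph' E σ) k r ((d : ℝ) ^ k / Fintype.card α) η θ := by
  subst hη hθ
  have h := abs_stepMatrix_altDigraph_pow_sub_le hE hd1 hδ hν hd hexp hm q σ
  rw [← hk] at h
  refine ⟨pathBounds_of_abs_pow_sub_le (hE.altDigraph σ) hd1 hk2 h r,
    pathBounds_of_abs_pow_sub_le (hE.altDigraph σ).swap hd1 hk2 (fun x y => ?_) r⟩
  have e : stepMatrix (fun x y => altDigraph E σ y x) d =
      (stepMatrix (altDigraph E σ) d).transpose := rfl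
  rw [e, ← Matrix.transpose_pow, Matrix.transpose_apply]
  exact h y x

end PathBounds

section SizeBias

open scoped Classical

variable {α : Type*} [Fintype α] [DecidableEq α]

/-- A bipartite graph in which every perfect matching has about the expected number of
alternating cycles of length `k + 1` through any given edge. -/
structure Switchable (E : α → α → Prop) (d k r : ℕ) (T η θ : ℝ) : Prop where
  one_le_k : 1 ≤ k
  one_le_d : 1 ≤ d
  one_le_r : 1 ≤ r
  T_pos : 0 < T
  η_nonneg : 0 ≤ η
  η_le_one : η ≤ 1
  θ_nonneg : 0 ≤ θ
  biRegular : ∀ σ ∈ matchings E, BiRegular (altDigraph E σ) d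
  pathBounds : ∀ σ ∈ matchings E, PathBounds (altDigraph E σ) k r T η θ
  pathBounds' : ∀ σ ∈ matchings E, PathBounds (altDigraph' E σ) k r T η θ

variable {E : α → α → Prop} {d k r : ℕ} {T η θ γ : ℝ}

lemma Switchable.abs_sub_le (h : Switchable E d k r T η θ) (hγ : γ = η + 2 * θ + 4 * r / d)
    {N : Finset (α × α)} (hN₁ : ∀ x, (univ.filter fun y => (x, y) ∈ N).card ≤ r)
    (hN₂ : ∀ y, (univ.filter fun x => (x, y) ∈ N).card ≤ r) {a b : α} (hE : E a b)
    (hN : (a, b) ∈ N) (g : ℕ → ℝ) {G : ℝ} (hg : ∀ i, |g i| ≤ G) :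
    |(d - 1) * ∑ σ ∈ matchings E with σ a = b, g (hits N σ) -
      ∑ σ ∈ matchings E with σ a ≠ b, g (hits N σ + 1)| ≤
    G * (γ * (d * ((matchings E).filter fun σ => σ a = b).card + (matchings E).card)) := by
  have hG : 0 ≤ G := (abs_nonneg _).trans (hg 0)
  have hd : (1 : ℝ) ≤ d := by exact_mod_cast h.one_le_d
  refine (switching_inequality h.one_le_k h.one_le_d h.T_pos h.η_nonneg h.biRegular
    h.pathBounds h.pathBounds' hN₁ hN₂ hE hN g hg).trans (mul_le_mul_of_nonneg_left ?_ hG)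
  have hsum := card_filter_add_card_filter_not (s := matchings E) fun σ => σ a = b
  rw [← hsum, hγ]
  push_cast
  set p : ℝ := (((matchings E).filter fun σ => σ a = b).card : ℝ)
  set q : ℝ := (((matchings E).filter fun σ => ¬ σ a = b).card : ℝ)
  have hp : 0 ≤ p := by positivity
  have hq : 0 ≤ q := by positivity
  have hη := h.η_nonneg
  have hη1 := h.η_le_one
  have hθ := h.θ_nonneg
  have h1 : (4 * r / d : ℝ) * (d * p + (p + q)) = 4 * r * p + 4 * r / d * (p + q) := by
    field_simp
  have h2 : 2 * r * (1 + η) * p ≤ 4 * r * p := by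
    have : 0 ≤ 2 * (r : ℝ) * p := by positivity
    nlinarith
  have h3 : 0 ≤ (4 * r / d : ℝ) * (p + q) := by positivity
  have h4 : (η + 2 * θ) * ((d - 1) * p + q) ≤ (η + 2 * θ) * (d * p + (p + q)) := by
    gcongr <;> linarith
  rw [add_mul _ (4 * r / d : ℝ), h1]
  linarith

lemma Switchable.abs_card_sub_le (h : Switchable E d k r T η θ)
    (hγ : γ = η + 2 * θ + 4 * r / d) (hγ1 : γ ≤ 1 / 3) {a b : α} (hE : E a b) :
    |d * (((matchings E).filter fun σ => σ a = b).card : ℝ) - (matchings E).card| ≤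
      3 * γ * (matchings E).card := by
  have hr := h.one_le_r
  have h1 := h.abs_sub_le hγ (N := {(a, b)})
    (fun x => (card_le_one.2 (by simp +contextual)).trans hr)
    (fun x => (card_le_one.2 (by simp +contextual)).trans hr) hE (mem_singleton_self _)
    (fun _ => 1) (G := 1) (by simp)
  have hsum := card_filter_add_card_filter_not (s := matchings E) fun σ => σ a = b
  have hsum' : (((matchings E).filter fun σ => σ a = b).card : ℝ) +
    ((matchings E).filter fun σ => ¬ σ a = b).card = (matchings E).card := by exact_mod_cast hsum
  have hγ0 : 0 ≤ γ := by
    have := h.η_nonneg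
    have := h.θ_nonneg
    rw [hγ]
    positivity
  simp only [sum_const, nsmul_eq_mul, mul_one, one_mul, ne_eq] at h1
  set p : ℝ := (((matchings E).filter fun σ => σ a = b).card : ℝ)
  set q : ℝ := (((matchings E).filter fun σ => ¬ σ a = b).card : ℝ)
  set t : ℝ := ((matchings E).card : ℝ)
  have ht : 0 ≤ t := by positivity
  have e : (d - 1) * p - q = d * p - t := by rw [← hsum']; ring
  rw [e] at h1
  have h2 : d * p ≤ 2 * t := by
    have h3 := (abs_le.1 h1).2
    have : γ * (d * p + t) ≤ 1 / 3 * (d * p + t) := by gcongr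
    linarith
  refine h1.trans ?_
  have : γ * (d * p + t) ≤ γ * (2 * t + t) := by gcongr
  linarith

lemma sum_hits_mul (N : Finset (α × α)) (s : Finset (Equiv.Perm α)) (g : ℕ → ℝ) :
    ∑ σ ∈ s, hits N σ * g (hits N σ) =
      ∑ p ∈ N, ∑ σ ∈ s with σ p.1 = p.2, g (hits N σ) := by
  simp only [sum_filter]
  rw [sum_comm]
  refine sum_congr rfl fun σ _ => ?_
  rw [← sum_filter, sum_const, nsmul_eq_mul]
  congr 2
  refine card_bij (fun x _ => (x, σ x)) (fun x hx => ?_) (fun x _ y _ hxy => ?_)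
    fun p hp => ⟨p.1, ?_, ?_⟩
  · simpa using hx
  · exact congrArg Prod.fst hxy
  · obtain ⟨h1, h2⟩ := mem_filter.1 hp
    simpa [h2] using h1
  · exact Prod.ext rfl (mem_filter.1 hp).2

/-- An approximate form of the identity characterising the Poisson distribution. -/
lemma Switchable.abs_sum_hits_mul_sub_le (h : Switchable E d k r T η θ)
    (hγ : γ = η + 2 * θ + 4 * r / d) (hγ1 : γ ≤ 1 / 3)
    {N : Finset (α × α)} (hN₁ : ∀ x, (univ.filter fun y => (x, y) ∈ N).card ≤ r)
    (hN₂ : ∀ y, (univ.filter fun x => (x, y) ∈ N).card ≤ r) (hN : ∀ p ∈ N, E p.1 p.2)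
    (g : ℕ → ℝ) {G : ℝ} (hg : ∀ i, |g i| ≤ G) :
    |∑ σ ∈ matchings E, hits N σ * g (hits N σ) -
      N.card / d * ∑ σ ∈ matchings E, g (hits N σ + 1)| ≤
      4 * G * γ * (N.card / d) * (matchings E).card := by
  have hG : 0 ≤ G := (abs_nonneg _).trans (hg 0)
  have hd : (0 : ℝ) < d := by exact_mod_cast h.one_le_d
  set t : ℝ := ((matchings E).card : ℝ)
  have ht : 0 ≤ t := by positivity
  have hγ0 : 4 / d ≤ γ := by
    have := h.η_nonneg
    have := h.θ_nonneg
    have : (1 : ℝ) ≤ r := by exact_mod_cast h.one_le_r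
    have : (4 : ℝ) / d ≤ 4 * r / d := by gcongr; linarith
    rw [hγ]
    linarith
  have key : ∀ p ∈ N, |d * ∑ σ ∈ matchings E with σ p.1 = p.2, g (hits N σ) -
      ∑ σ ∈ matchings E, g (hits N σ + 1)| ≤ 4 * G * γ * t := by
    intro p hp
    have h1 := h.abs_sub_le hγ hN₁ hN₂ (hN p hp) hp g hg
    have h2 := h.abs_card_sub_le hγ hγ1 (hN p hp)
    have h0 := sum_filter_add_sum_filter_not (matchings E) (fun σ => σ p.1 = p.2)
      fun σ => g (hits N σ + 1)
    have h3 : ∀ f : Equiv.Perm α → ℕ, |∑ σ ∈ matchings E with σ p.1 = p.2, g (f σ)| ≤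
        ((matchings E).filter fun σ => σ p.1 = p.2).card * G := fun f => by
      rw [← nsmul_eq_mul]
      exact (abs_sum_le_sum_abs _ _).trans (sum_le_card_nsmul _ _ _ fun σ _ => hg _)
    have h4 := h3 (hits N)
    have h5 := h3 fun σ => hits N σ + 1
    set c : ℝ := (((matchings E).filter fun σ => σ p.1 = p.2).card : ℝ)
    have h6 : d * c ≤ 2 * t := by
      have := (abs_le.1 h2).2
      have : γ * t ≤ 1 / 3 * t := by gcongr
      linarith
    have h7 : 2 * (c * G) ≤ G * (γ * t) := by
      have h8 : c ≤ 2 * t / d := by rw [le_div_iff₀ hd]; linarith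
      calc 2 * (c * G) ≤ 2 * (2 * t / d * G) := by gcongr
        _ = G * (4 / d * t) := by ring
        _ ≤ _ := by gcongr
    have h8 : G * (γ * (d * c + t)) ≤ G * (γ * (2 * t + t)) := by
      have : 0 ≤ γ := le_trans (by positivity) hγ0
      gcongr
    rw [← h0]
    simp only [ne_eq] at h1
    rw [abs_le] at h1 h4 h5 ⊢
    constructor <;> linarith
  have e : d * (∑ σ ∈ matchings E, hits N σ * g (hits N σ) -
      N.card / d * ∑ σ ∈ matchings E, g (hits N σ + 1)) =
      ∑ p ∈ N, (d * ∑ σ ∈ matchings E with σ p.1 = p.2, g (hits N σ) -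
      ∑ σ ∈ matchings E, g (hits N σ + 1)) := by
    rw [sum_hits_mul, sum_sub_distrib, ← mul_sum, sum_const, nsmul_eq_mul]
    field_simp
  have h1 := (abs_sum_le_sum_abs _ _).trans (sum_le_card_nsmul _ _ _ key)
  rw [← e, abs_mul, abs_of_pos hd, nsmul_eq_mul] at h1
  refine le_of_mul_le_mul_left (h1.trans (le_of_eq ?_)) hd
  field_simp

end SizeBias

section Poisson

lemma hasSum_poissonPMF {lam : ℝ} (h : 0 ≤ lam) : HasSum (poissonPMF lam) 1 :=
  ProbabilityTheory.hasSum_one_poissonMeasure ⟨lam, h⟩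

lemma poissonPMF_pos {lam : ℝ} (h : 0 < lam) (k : ℕ) : 0 < poissonPMF lam k := by
  unfold poissonPMF; positivity

lemma poissonPMF_succ (lam : ℝ) (k : ℕ) :
    (k + 1) * poissonPMF lam (k + 1) = lam * poissonPMF lam k := by
  unfold poissonPMF
  rw [Nat.factorial_succ]
  push_cast
  field_simp
  ring

lemma sum_range_poissonPMF_le {lam : ℝ} (h : 0 < lam) (k : ℕ) (hk : (k + 1 : ℝ) ≤ lam) :
    ∑ i ∈ range (k + 1), poissonPMF lam i ≤ lam * poissonPMF lam k := by
  have mono : ∀ j : ℕ, (j : ℝ) ≤ lam → ∑ i ∈ range (j + 1), poissonPMF lam i ≤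
      (j + 1) * poissonPMF lam j := by
    intro j
    induction j with
    | zero => simp
    | succ j ih =>
      intro hj
      push_cast at hj ⊢
      rw [sum_range_succ]
      have h1 := poissonPMF_succ lam j
      have h2 := ih (by linarith)
      have h3 : (j + 1 : ℝ) * poissonPMF lam j ≤ lam * poissonPMF lam j :=
        mul_le_mul_of_nonneg_right hj (poissonPMF_pos h j).le
      linarith
  exact (mono k (by linarith)).trans (mul_le_mul_of_nonneg_right hk (poissonPMF_pos h k).le)

lemma tsum_poissonPMF_add_le {lam : ℝ} (h : 0 < lam) (k : ℕ) (hk : lam ≤ k + 1) :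
    ∑' i, poissonPMF lam (i + (k + 1)) ≤ 2 * (lam * poissonPMF lam k) := by
  set c : ℝ := (k + 1) / (k + 2) with hc
  have hc0 : 0 ≤ c := by positivity
  have hc1 : c < 1 := by rw [hc, div_lt_one (by positivity)]; linarith
  have hle : ∀ i, poissonPMF lam (i + (k + 1)) ≤ poissonPMF lam (k + 1) * c ^ i := by
    intro i
    induction i with
    | zero => simp
    | succ i ih =>
      have h1 := poissonPMF_succ lam (i + (k + 1))
      have h2 : poissonPMF lam (i + (k + 1) + 1) ≤ c * poissonPMF lam (i + (k + 1)) := by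
        have h3 : poissonPMF lam (i + (k + 1) + 1) =
            lam / (i + (k + 1) + 1) * poissonPMF lam (i + (k + 1)) := by
          push_cast at h1
          field_simp
          linarith
        rw [h3]
        refine mul_le_mul_of_nonneg_right ?_ (poissonPMF_pos h _).le
        rw [hc]
        rw [div_le_div_iff₀ (by positivity) (by positivity)]
        have hi : (0 : ℝ) ≤ i := Nat.cast_nonneg i
        nlinarith [mul_le_mul_of_nonneg_right hk (by positivity : (0 : ℝ) ≤ k + 2)]
      rw [show i + 1 + (k + 1) = i + (k + 1) + 1 by ring, pow_succ']
      refine h2.trans ?_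
      rw [mul_left_comm]
      gcongr
  have hs := (summable_geometric_of_lt_one hc0 hc1).mul_left (poissonPMF lam (k + 1))
  refine (((summable_nat_add_iff (k + 1)).2 (hasSum_poissonPMF h.le).summable).tsum_le_tsum
    hle hs).trans ?_
  rw [tsum_mul_left, tsum_geometric_of_lt_one hc0 hc1]
  have h1 := poissonPMF_succ lam k
  have h2 : (1 - c)⁻¹ = k + 2 := by
    rw [hc, one_sub_div (by positivity)]
    ring_nf
    simp
  rw [h2, ← h1]
  have := (poissonPMF_pos h (k + 1)).le
  nlinarith [(Nat.cast_nonneg k : (0 : ℝ) ≤ k)]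

lemma hasSum_ite_mem (A : Finset ℕ) (f : ℕ → ℝ) :
    HasSum (fun k => if k ∈ A then f k else 0) (∑ k ∈ A, f k) := by
  rw [sum_congr rfl fun k hk => (if_pos hk : (if k ∈ A then f k else 0) = f k).symm]
  exact hasSum_sum_of_ne_finset_zero fun k hk => if_neg hk

/-- The bounded solution of Stein's equation for the Poisson distribution. -/
lemma exists_stein_solution {lam : ℝ} (h : 0 < lam) (A : Finset ℕ) :
    ∃ g : ℕ → ℝ, (∀ k, |g k| ≤ 2) ∧ ∀ k : ℕ, lam * g (k + 1) - k * g k =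
      (if k ∈ A then 1 else 0) - ∑ i ∈ A, poissonPMF lam i := by
  set a : ℝ := ∑ i ∈ A, poissonPMF lam i with ha
  have hpos := poissonPMF_pos h
  have hsum := hasSum_poissonPMF h.le
  have ha0 : 0 ≤ a := sum_nonneg fun i _ => (hpos i).le
  have ha1 : a ≤ 1 := sum_le_hasSum _ (fun i _ => (hpos i).le) hsum
  set f : ℕ → ℝ := fun i => poissonPMF lam i * ((if i ∈ A then 1 else 0) - a) with hf
  have hfle : ∀ i, |f i| ≤ poissonPMF lam i := by
    intro i
    rw [hf, abs_mul, abs_of_pos (hpos i)]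
    refine mul_le_of_le_one_right (hpos i).le ?_
    split_ifs <;> rw [abs_le] <;> constructor <;> linarith
  have hfsum : HasSum f 0 := by
    have h1 := (hasSum_ite_mem A (poissonPMF lam)).sub (hsum.mul_right a)
    rw [← ha, one_mul, sub_self] at h1
    refine (funext fun i => ?_ : _ = f) ▸ h1
    simp only [hf]
    split_ifs <;> ring
  set S : ℕ → ℝ := fun k => ∑ i ∈ range k, f i with hS
  have hSle : ∀ k, |S (k + 1)| ≤ 2 * (lam * poissonPMF lam k) := by
    intro k
    have hp : 0 ≤ lam * poissonPMF lam k := mul_nonneg h.le (hpos k).le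
    rcases le_total (k + 1 : ℝ) lam with hk | hk
    · refine (abs_sum_le_sum_abs _ _).trans ((sum_le_sum fun i _ => hfle i).trans ?_)
      have := sum_range_poissonPMF_le h k hk
      linarith
    · have h1 := hfsum.summable.sum_add_tsum_nat_add (k + 1)
      rw [hfsum.tsum_eq] at h1
      have h2 : S (k + 1) = - ∑' i, f (i + (k + 1)) := by simp only [hS]; linarith
      rw [h2, abs_neg]
      refine le_trans ?_ (tsum_poissonPMF_add_le h k hk)
      have h3 := (summable_nat_add_iff (k + 1)).2 hsum.summable
      exact tsum_of_norm_bounded (f := fun i => f (i + (k + 1))) h3.hasSum fun i => hfle (i + (k + 1))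
  refine ⟨fun k => S k / (k * poissonPMF lam k), fun k => ?_, fun k => ?_⟩
  · rcases k with _ | k
    · simp
    · have := poissonPMF_succ lam k
      push_cast
      rw [this, abs_div, abs_of_pos (mul_pos h (hpos k)), div_le_iff₀ (mul_pos h (hpos k))]
      exact hSle k
  · have e1 : ((k + 1 : ℕ) : ℝ) * poissonPMF lam (k + 1) = lam * poissonPMF lam k := by
      push_cast; exact poissonPMF_succ lam k
    have e2 : (k : ℝ) * (S k / (k * poissonPMF lam k)) = S k / poissonPMF lam k := by
      rcases k with _ | k
      · simp [hS]
      · have := (hpos (k + 1)).ne'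
        field_simp
    have e3 : S (k + 1) = S k + f k := sum_range_succ _ _
    have h1 := (hpos k).ne'
    simp only
    rw [e1, e2, e3]
    simp only [hf]
    field_simp
    ring

/-- Stein's method for Poisson approximation. -/
lemma tsum_abs_sub_poissonPMF_le {ι : Type*} (s : Finset ι) (hs : s.Nonempty) (X : ι → ℕ)
    {lam e : ℝ} (h : 0 < lam)
    (hX : ∀ g : ℕ → ℝ, (∀ k, |g k| ≤ 2) →
      |∑ i ∈ s, X i * g (X i) - lam * ∑ i ∈ s, g (X i + 1)| ≤ e * s.card) :
    1 / 2 * ∑' k, |((s.filter fun i => X i = k).card : ℝ) / s.card - poissonPMF lam k| ≤ e := by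
  classical
  have hs' : (0 : ℝ) < s.card := by exact_mod_cast hs.card_pos
  have hpos := poissonPMF_pos h
  set p : ℕ → ℝ := fun k => ((s.filter fun i => X i = k).card : ℝ) / s.card with hp
  have hp0 : ∀ k ∉ s.image X, p k = 0 := by
    intro k hk
    have : (s.filter fun i => X i = k) = ∅ := by
      rw [filter_eq_empty_iff]
      rintro i hi rfl
      exact hk (mem_image_of_mem _ hi)
    simp [hp, this]
  have hpsum : HasSum p 1 := by
    have h1 : ∑ k ∈ s.image X, p k = 1 := by
      simp only [hp]
      rw [← sum_div, ← Nat.cast_sum, ← card_eq_sum_card_image, div_self hs'.ne']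
    exact h1 ▸ hasSum_sum_of_ne_finset_zero hp0
  set A := (s.image X).filter fun k => poissonPMF lam k < p k with hA
  obtain ⟨g, hg, hgA⟩ := exists_stein_solution h A
  have hAout : ∀ k ∉ A, p k ≤ poissonPMF lam k := by
    intro k hk
    by_cases hk' : k ∈ s.image X
    · by_contra hcon
      exact hk (mem_filter.2 ⟨hk', not_le.1 hcon⟩)
    · rw [hp0 k hk']; exact (hpos k).le
  have htv : HasSum (fun k => |p k - poissonPMF lam k|)
      (2 * ∑ k ∈ A, (p k - poissonPMF lam k)) := by
    have h1 := ((hasSum_ite_mem A fun k => p k - poissonPMF lam k).mul_left 2).sub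
      (hpsum.sub (hasSum_poissonPMF h.le))
    rw [sub_self, sub_zero] at h1
    refine (funext fun k => ?_ : _ = fun k => |p k - poissonPMF lam k|) ▸ h1
    split_ifs with hk
    · rw [abs_of_pos (sub_pos.2 (mem_filter.1 hk).2)]; ring
    · rw [abs_of_nonpos (sub_nonpos.2 (hAout k hk))]; ring
  rw [htv.tsum_eq]
  have h1 := (abs_le.1 (hX g hg)).1
  have h2 : lam * ∑ i ∈ s, g (X i + 1) - ∑ i ∈ s, X i * g (X i) =
      s.card * ∑ k ∈ A, (p k - poissonPMF lam k) := by
    rw [mul_sum, ← sum_sub_distrib, sum_congr rfl fun i _ => hgA (X i), sum_sub_distrib,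
      sum_boole, sum_const, nsmul_eq_mul, sum_sub_distrib, mul_sub]
    congr 1
    rw [card_eq_sum_card_fiberwise (f := X) (t := A) (s := s.filter fun i => X i ∈ A)
      (fun i hi => (mem_filter.1 hi).2)]
    push_cast
    rw [mul_sum]
    refine sum_congr rfl fun k hk => ?_
    simp only [hp]
    rw [mul_div_cancel₀ _ hs'.ne', filter_filter]
    congr 2
    ext i
    simp only [mem_filter]
    constructor
    · exact fun hi => ⟨hi.1, hi.2.2⟩
    · rintro ⟨hi, rfl⟩
      exact ⟨hi, hk, rfl⟩
  have h3 : s.card * ∑ k ∈ A, (p k - poissonPMF lam k) ≤ s.card * e := by linarith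
  have := le_of_mul_le_mul_left h3 hs'
  linarith

lemma tsum_abs_sub_poissonPMF_zero {ι : Type*} (s : Finset ι) (hs : s.Nonempty) (X : ι → ℕ)
    (hX : ∀ i ∈ s, X i = 0) :
    ∑' k, |((s.filter fun i => X i = k).card : ℝ) / s.card - poissonPMF 0 k| = 0 := by
  have hs' : (s.card : ℝ) ≠ 0 := by exact_mod_cast hs.card_pos.ne'
  convert tsum_zero with k
  rcases k with _ | k
  · rw [filter_true_of_mem hX, div_self hs']
    simp [poissonPMF]
  · rw [filter_false_of_mem fun i hi => by rw [hX i hi]; simp]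
    simp [poissonPMF]

end Poisson

section Asymptotics

open scoped Classical

lemma exists_error_le {a C ε : ℝ} (ha : 0 ≤ a) (ha1 : a < 1) (hε : 0 < ε) :
    ∃ Q : ℕ, 2 ≤ Q ∧ ∀ q : ℕ, Q ≤ q → 16 * ((q : ℝ) ^ 5 * a ^ q) + C / q ≤ ε := by
  have h1 := (tendsto_pow_const_mul_const_pow_of_lt_one 5 ha ha1).const_mul 16
  have h2 := h1.add (tendsto_const_div_atTop_nhds_zero_nat C)
  rw [mul_zero, add_zero] at h2
  obtain ⟨Q, hQ⟩ := Filter.eventually_atTop.1 (h2.eventually_le_const hε)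
  exact ⟨max Q 2, le_max_right _ _, fun q hq => hQ q ((le_max_left _ _).trans hq)⟩

lemma exists_fourth_root {Q n : ℕ} (h : Q ^ 4 ≤ n) :
    ∃ q, Q ≤ q ∧ q ^ 4 ≤ n ∧ n < (q + 1) ^ 4 := by
  have h1 := Nat.sqrt_le' n
  have h2 := Nat.lt_succ_sqrt' n
  set s := Nat.sqrt n
  have h3 := Nat.sqrt_le' s
  have h4 := Nat.lt_succ_sqrt' s
  set q := Nat.sqrt s
  have h5 : n < (q + 1) ^ 4 := by
    calc n < (s + 1) ^ 2 := h2
      _ ≤ ((q + 1) ^ 2) ^ 2 := Nat.pow_le_pow_left h4 2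
      _ = _ := by ring
  refine ⟨q, ?_, ?_, h5⟩
  · exact Nat.lt_succ_iff.1 (lt_of_pow_lt_pow_left₀ 4 (Nat.zero_le _) (h.trans_lt h5))
  · calc q ^ 4 = (q ^ 2) ^ 2 := by ring
      _ ≤ s ^ 2 := Nat.pow_le_pow_left h3 2
      _ ≤ n := h1

lemma error_mul_le {δ n d q K r w : ℝ} (hδ : 0 < δ) (hq : 1 ≤ q) (hK : 1 ≤ K)
    (hr : r ≤ q) (hw : 0 ≤ w) (hqn : q ^ 4 ≤ n) (hnq : n ≤ (q + 1) ^ 4) (hd : δ * n ≤ d) :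
    (n * w + (K * q + 1) ^ 2 * n / d ^ 2 + 2 * (K * q * r * n / d ^ 2) + 4 * r / d) * q ≤
      16 * (q ^ 5 * w) + ((4 * K ^ 2 + 2 * K) / δ ^ 2 + 4 / δ) / q := by
  have hn : 0 < n := lt_of_lt_of_le (by positivity) hqn
  have hd0 : 0 < d := lt_of_lt_of_le (by positivity) hd
  have h1 : n / d ^ 2 ≤ 1 / (δ ^ 2 * q ^ 4) := by
    calc n / d ^ 2 ≤ n / (δ * n) ^ 2 := by gcongr
      _ = 1 / (δ ^ 2 * n) := by field_simp
      _ ≤ _ := by gcongr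
  have h2 : n * w * q ≤ 16 * (q ^ 5 * w) := by
    calc n * w * q ≤ (q + q) ^ 4 * w * q := by
          gcongr
          exact hnq.trans (by gcongr)
      _ = _ := by ring
  have h3 : (K * q + 1) ^ 2 * n / d ^ 2 * q ≤ 4 * K ^ 2 / δ ^ 2 / q := by
    have : K * q + 1 ≤ 2 * (K * q) := by nlinarith
    calc (K * q + 1) ^ 2 * n / d ^ 2 * q = (K * q + 1) ^ 2 * (n / d ^ 2) * q := by ring
      _ ≤ (2 * (K * q)) ^ 2 * (1 / (δ ^ 2 * q ^ 4)) * q := by gcongr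
      _ = _ := by field_simp; ring
  have h4 : 2 * (K * q * r * n / d ^ 2) * q ≤ 2 * K / δ ^ 2 / q := by
    calc 2 * (K * q * r * n / d ^ 2) * q = 2 * (K * q * r * (n / d ^ 2)) * q := by ring
      _ ≤ 2 * (K * q * q * (1 / (δ ^ 2 * q ^ 4))) * q := by gcongr
      _ = _ := by field_simp
  have h5 : 4 * r / d * q ≤ 4 / δ / q := by
    have hq3 : q ^ 3 ≤ q ^ 4 := pow_le_pow_right₀ hq (by norm_num)
    calc 4 * r / d * q ≤ 4 * q / (δ * q ^ 3) * q := by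
          gcongr
          exact le_trans (by gcongr; exact hq3.trans hqn) hd
      _ = _ := by field_simp
  calc _ = n * w * q + (K * q + 1) ^ 2 * n / d ^ 2 * q + 2 * (K * q * r * n / d ^ 2) * q +
        4 * r / d * q := by ring
    _ ≤ 16 * (q ^ 5 * w) + 4 * K ^ 2 / δ ^ 2 / q + 2 * K / δ ^ 2 / q + 4 / δ / q := by gcongr
    _ = _ := by ring

lemma nat_le_of_le_rpow {r n q : ℕ} (hr : (r : ℝ) ≤ (n : ℝ) ^ ((1 : ℝ) / 50))
    (hn : n < (q + 1) ^ 4) : r ≤ q := by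
  have h1 : (r : ℝ) ^ 50 ≤ (n : ℝ) := by
    have h := pow_le_pow_left₀ (Nat.cast_nonneg r) hr 50
    rw [← Real.rpow_natCast _ 50, ← Real.rpow_natCast _ 50,
      ← Real.rpow_mul (Nat.cast_nonneg n)] at h
    norm_num at h
    exact_mod_cast h
  have h2 : r ^ 50 ≤ n := by exact_mod_cast h1
  have h3 : r ^ 50 < (q + 1) ^ 50 :=
    h2.trans_lt (hn.trans_le (Nat.pow_le_pow_right (Nat.succ_pos q) (by norm_num)))
  exact Nat.lt_succ_iff.1 (lt_of_pow_lt_pow_left₀ 50 (Nat.zero_le _) h3)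

lemma exists_switchable {δ ν ε : ℝ} (hδ : 0 < δ) (hν : 0 < ν) (hε : 0 < ε) :
    ∃ n₀ : ℕ, ∀ n : ℕ, n₀ ≤ n → ∀ d : ℕ, δ * n ≤ d → ∀ r : ℕ, 1 ≤ r →
      (r : ℝ) ≤ (n : ℝ) ^ ((1 : ℝ) / 50) →
      ∀ (α : Type) [Fintype α] [DecidableEq α], Fintype.card α = n →
      ∀ E : α → α → Prop, BiRegular E d →
      (∀ S : Finset α, δ / 2 * n ≤ S.card → (S.card : ℝ) ≤ (1 - δ / 2) * n →
        S.card + ν * n ≤ ((univ.filter fun y => ν * n ≤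
          ((univ.filter fun z => E z y ∧ z ∈ S).card : ℝ)).card : ℝ)) →
      ∃ (k : ℕ) (T η θ γ : ℝ), Switchable E d k r T η θ ∧ γ = η + 2 * θ + 4 * r / d ∧
        γ ≤ 1 / 3 ∧ 3 * γ ≤ ε ∧ 8 * γ * (r / δ) ≤ ε := by
  obtain ⟨m, hm⟩ := exists_nat_gt (1 / ν)
  have hm' : 1 < δ + m * ν := by
    rw [div_lt_iff₀ hν] at hm
    linarith
  set κ : ℝ := min ν (1 / 2) with hκ
  have hκ0 : 0 < κ := lt_min hν (by norm_num)
  have hκ1 : κ ≤ 1 := (min_le_right _ _).trans (by norm_num)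
  have ha : 0 ≤ 1 - κ ^ m := sub_nonneg.2 (pow_le_one₀ hκ0.le hκ1)
  have ha1 : 1 - κ ^ m < 1 := sub_lt_self _ (by positivity)
  set ε' : ℝ := min (1 / 3) (min (ε / 3) (ε * δ / 8)) with hε'
  have hε'0 : 0 < ε' := lt_min (by norm_num) (lt_min (by positivity) (by positivity))
  obtain ⟨Q, hQ2, hQ⟩ := exists_error_le
    (C := (4 * ((m : ℝ) + 1) ^ 2 + 2 * ((m : ℝ) + 1)) / δ ^ 2 + 4 / δ) ha ha1 hε'0
  refine ⟨Q ^ 4, fun n hn d hd r hr1 hr α _ _ hα E hE hexp => ?_⟩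
  obtain ⟨q, hQq, hqn, hnq⟩ := exists_fourth_root hn
  have hq2 := hQ2.trans hQq
  have hq1 : (1 : ℝ) ≤ q := by exact_mod_cast (by omega : 1 ≤ q)
  have hn0 : 0 < n := lt_of_lt_of_le (by positivity) hqn
  have hn0' : (0 : ℝ) < n := by exact_mod_cast hn0
  have hd0 : (0 : ℝ) < d := lt_of_lt_of_le (by positivity) hd
  have hd1 : 1 ≤ d := by exact_mod_cast hd0
  have hrq := nat_le_of_le_rpow hr hnq
  have hrq' : (r : ℝ) ≤ q := by exact_mod_cast hrq
  subst hα
  set n := Fintype.card α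
  have herr := (error_mul_le (K := (m : ℝ) + 1) (r := r) hδ hq1
    (by linarith [(Nat.cast_nonneg m : (0 : ℝ) ≤ m)])
    hrq' (pow_nonneg ha q) (by exact_mod_cast hqn)
    (by exact_mod_cast hnq.le) hd).trans (hQ q hQq)
  set k := (m + 1) * q with hk
  have hk2 : 2 ≤ k := hq2.trans (Nat.le_mul_of_pos_left q (Nat.succ_pos m))
  have hkcast : ((m : ℝ) + 1) * q = k := by rw [hk]; push_cast; ring
  rw [hkcast] at herr
  set η : ℝ := n * (1 - κ ^ m) ^ q + ((k : ℝ) + 1) ^ 2 * n / (d : ℝ) ^ 2 with hη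
  set θ : ℝ := k * r * n / (d : ℝ) ^ 2 with hθ
  set γ : ℝ := η + 2 * θ + 4 * r / d with hγ
  have hη0 : 0 ≤ η := by
    have := pow_nonneg ha q
    positivity
  have hθ0 : 0 ≤ θ := by positivity
  have hr0 : 0 ≤ (4 * r / d : ℝ) := by positivity
  have hγ0 : 0 ≤ γ := by positivity
  have hγle : γ ≤ ε' := le_trans (le_mul_of_one_le_right hγ0 hq1) herr
  have hγ3 : γ ≤ 1 / 3 := hγle.trans (min_le_left _ _)
  have hPB := pathBounds_altDigraph hE hd1 hδ hν hd
    (fun S h1 h2 => by convert hexp S h1 h2) hm' hk hk2 r hη hθ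
  refine ⟨k, (d : ℝ) ^ k / n, η, θ, γ, ⟨by omega, hd1, hr1, by positivity, hη0, by linarith,
    hθ0, fun σ _ => hE.altDigraph σ, fun σ _ => (hPB σ).1, fun σ _ => (hPB σ).2⟩, rfl, hγ3, ?_, ?_⟩
  · have := hγle.trans ((min_le_right _ _).trans (min_le_left _ _))
    linarith
  · have h1 := herr.trans ((min_le_right _ _).trans (min_le_right _ _))
    have h2 : γ * r ≤ ε * δ / 8 := le_trans (by gcongr) h1
    rw [← mul_div_assoc, div_le_iff₀ hδ]
    linarith

end Asymptotics

section Encoding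

open scoped Classical

variable {V : Type*} {A B : Set V}

/-- The adjacency of a bipartite graph, with its parts identified by `φ`. -/
def bipRel (G : SimpleGraph V) (φ : A ≃ B) : A → A → Prop := fun a b => G.Adj a (φ b)

/-- The edge encoded by a pair when the parts are identified by `φ`. -/
def pairEdge (φ : A ≃ B) (p : A × A) : Sym2 V := s((p.1 : V), (φ p.2 : V))

variable {φ : A ≃ B} {G : SimpleGraph V}

lemma coe_mem_pairEdge (hdisj : Disjoint A B) (a : A) (p : A × A) :
    (a : V) ∈ pairEdge φ p ↔ a = p.1 := by
  rw [pairEdge, Sym2.mem_iff, Subtype.coe_inj]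
  refine or_iff_left fun h => ?_
  exact Set.disjoint_left.1 hdisj a.2 (h ▸ (φ p.2).2)

lemma coe_equiv_mem_pairEdge (hdisj : Disjoint A B) (b : A) (p : A × A) :
    (φ b : V) ∈ pairEdge φ p ↔ b = p.2 := by
  rw [pairEdge, Sym2.mem_iff, Subtype.coe_inj, φ.injective.eq_iff]
  refine or_iff_right fun h => ?_
  exact Set.disjoint_left.1 hdisj p.1.2 (h ▸ (φ b).2)

lemma pairEdge_injective (hdisj : Disjoint A B) : Function.Injective (pairEdge φ) := by
  intro p q h
  refine Prod.ext ?_ ?_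
  · rw [← coe_mem_pairEdge hdisj p.1 q, ← h, coe_mem_pairEdge hdisj]
  · rw [← coe_equiv_mem_pairEdge hdisj p.2 q, ← h, coe_equiv_mem_pairEdge hdisj]

lemma pairEdge_mem_edgeSet (p : A × A) : pairEdge φ p ∈ G.edgeSet ↔ bipRel G φ p.1 p.2 :=
  SimpleGraph.mem_edgeSet G

lemma exists_pairEdge_eq
    (hbip : ∀ u v : V, G.Adj u v → (u ∈ A ∧ v ∈ B) ∨ (u ∈ B ∧ v ∈ A)) {e : Sym2 V}
    (he : e ∈ G.edgeSet) : ∃ p, pairEdge φ p = e := by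
  induction e with
  | _ u v =>
    rcases hbip u v he with ⟨hu, hv⟩ | ⟨hu, hv⟩
    · exact ⟨(⟨u, hu⟩, φ.symm ⟨v, hv⟩), by simp [pairEdge]⟩
    · exact ⟨(⟨v, hv⟩, φ.symm ⟨u, hu⟩), by simp [pairEdge, Sym2.eq_swap]⟩

lemma mem_right_of_adj (hdisj : Disjoint A B)
    (hbip : ∀ u v : V, G.Adj u v → (u ∈ A ∧ v ∈ B) ∨ (u ∈ B ∧ v ∈ A)) {u v : V}
    (h : G.Adj u v) (hu : u ∈ A) : v ∈ B :=
  (hbip u v h).elim And.right fun h => absurd h.1 (Set.disjoint_left.1 hdisj hu)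

lemma mem_left_of_adj (hdisj : Disjoint A B)
    (hbip : ∀ u v : V, G.Adj u v → (u ∈ A ∧ v ∈ B) ∨ (u ∈ B ∧ v ∈ A)) {u v : V}
    (h : G.Adj u v) (hu : u ∈ B) : v ∈ A :=
  (hbip u v h).elim (fun h => absurd hu (Set.disjoint_left.1 hdisj h.1)) And.right

variable [Fintype A]

/-- The perfect matching encoded by a permutation. -/
noncomputable def permEdges (φ : A ≃ B) (σ : Equiv.Perm A) : Finset (Sym2 V) :=
  univ.image fun x => pairEdge φ (x, σ x)

lemma mem_permEdges {σ : Equiv.Perm A} {e : Sym2 V} :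
    e ∈ permEdges φ σ ↔ ∃ x, pairEdge φ (x, σ x) = e := by
  simp [permEdges]

lemma pairEdge_mem_permEdges (hdisj : Disjoint A B) {σ : Equiv.Perm A} {a b : A} :
    pairEdge φ (a, b) ∈ permEdges φ σ ↔ σ a = b := by
  rw [mem_permEdges]
  constructor
  · rintro ⟨x, hx⟩
    have h := pairEdge_injective hdisj hx
    rw [Prod.mk.injEq] at h
    rw [← h.1, h.2]
  · rintro rfl
    exact ⟨a, rfl⟩

lemma permEdges_injective (hdisj : Disjoint A B) : Function.Injective (permEdges φ) := by
  intro σ τ h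
  ext x
  have h1 : pairEdge φ (x, σ x) ∈ permEdges φ τ := h ▸ mem_permEdges.2 ⟨x, rfl⟩
  rw [(pairEdge_mem_permEdges hdisj).1 h1]

lemma isPM_permEdges [DecidableEq A] (hun : A ∪ B = Set.univ) (hdisj : Disjoint A B)
    {σ : Equiv.Perm A} (hσ : σ ∈ matchings (bipRel G φ)) : IsPM G (permEdges φ σ) := by
  rw [mem_matchings] at hσ
  refine ⟨fun e he => ?_, fun v => ?_⟩
  · obtain ⟨x, rfl⟩ := mem_permEdges.1 he
    exact (pairEdge_mem_edgeSet _).2 (hσ x)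
  · rcases (hun ▸ Set.mem_univ v : v ∈ A ∪ B) with hv | hv
    · lift v to A using hv
      refine ⟨pairEdge φ (v, σ v), ⟨mem_permEdges.2 ⟨v, rfl⟩,
        (coe_mem_pairEdge hdisj _ _).2 rfl⟩, ?_⟩
      rintro e ⟨he, hve⟩
      obtain ⟨x, rfl⟩ := mem_permEdges.1 he
      rw [(coe_mem_pairEdge hdisj _ _).1 hve]
    · obtain ⟨b, hb⟩ := φ.surjective ⟨v, hv⟩
      obtain rfl : (φ b : V) = v := by rw [hb]
      refine ⟨pairEdge φ (σ.symm b, b), ⟨mem_permEdges.2 ⟨σ.symm b, by simp⟩,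
        (coe_equiv_mem_pairEdge hdisj _ _).2 rfl⟩, ?_⟩
      rintro e ⟨he, hve⟩
      obtain ⟨x, rfl⟩ := mem_permEdges.1 he
      rw [(coe_equiv_mem_pairEdge hdisj _ _).1 hve]
      simp

lemma exists_permEdges_eq [DecidableEq A] (hdisj : Disjoint A B)
    (hbip : ∀ u v : V, G.Adj u v → (u ∈ A ∧ v ∈ B) ∨ (u ∈ B ∧ v ∈ A)) {M : Finset (Sym2 V)}
    (hM : IsPM G M) : ∃ σ ∈ matchings (bipRel G φ), permEdges φ σ = M := by
  have h : ∀ a : A, ∃ b, pairEdge φ (a, b) ∈ M := by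
    intro a
    obtain ⟨e, ⟨he, hae⟩, -⟩ := hM.2 a
    obtain ⟨p, rfl⟩ := exists_pairEdge_eq (φ := φ) hbip (hM.1 e he)
    rw [(coe_mem_pairEdge hdisj _ _).1 hae]
    exact ⟨p.2, he⟩
  choose f hf using h
  have hinj : Function.Injective f := by
    intro a a' haa
    have h1 := (hM.2 (φ (f a))).unique ⟨hf a, (coe_equiv_mem_pairEdge hdisj _ _).2 rfl⟩
      ⟨hf a', (coe_equiv_mem_pairEdge hdisj _ _).2 haa⟩
    exact congrArg Prod.fst (pairEdge_injective hdisj h1)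
  refine ⟨Equiv.ofBijective f (Finite.injective_iff_bijective.1 hinj), ?_, ?_⟩
  · exact mem_matchings.2 fun a => (pairEdge_mem_edgeSet (a, f a)).1 (hM.1 _ (hf a))
  · ext e
    rw [mem_permEdges]
    constructor
    · rintro ⟨x, rfl⟩
      exact hf x
    · intro he
      obtain ⟨p, rfl⟩ := exists_pairEdge_eq (φ := φ) hbip (hM.1 e he)
      exact ⟨p.1, (hM.2 p.1).unique ⟨hf p.1, (coe_mem_pairEdge hdisj _ _).2 rfl⟩
        ⟨he, (coe_mem_pairEdge hdisj _ _).2 rfl⟩⟩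

lemma card_isPM_and [DecidableEq A] (hun : A ∪ B = Set.univ) (hdisj : Disjoint A B)
    (hbip : ∀ u v : V, G.Adj u v → (u ∈ A ∧ v ∈ B) ∨ (u ∈ B ∧ v ∈ A))
    (Q : Finset (Sym2 V) → Prop) :
    Nat.card {M : Finset (Sym2 V) // IsPM G M ∧ Q M} =
      ((matchings (bipRel G φ)).filter fun σ => Q (permEdges φ σ)).card := by
  rw [← card_image_of_injective _ (permEdges_injective hdisj), ← Set.ncard_coe_finset,
    ← Nat.card_coe_set_eq]
  congr! with M
  simp only [coe_image, coe_filter, Set.mem_image, Set.mem_ofPred_eq]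
  constructor
  · rintro ⟨h1, h2⟩
    obtain ⟨σ, hσ, rfl⟩ := exists_permEdges_eq (φ := φ) hdisj hbip h1
    exact ⟨σ, ⟨hσ, h2⟩, rfl⟩
  · rintro ⟨σ, ⟨hσ, h2⟩, rfl⟩
    exact ⟨isPM_permEdges hun hdisj hσ, h2⟩

lemma card_permEdges_inter [DecidableEq V] [DecidableEq A] (hdisj : Disjoint A B)
    (σ : Equiv.Perm A) (N : Finset (Sym2 V)) :
    (permEdges φ σ ∩ N).card = hits (univ.filter fun p => pairEdge φ p ∈ N) σ := by
  have h : Function.Injective fun x => pairEdge φ (x, σ x) := fun x y hxy =>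
    congrArg Prod.fst (pairEdge_injective hdisj hxy)
  rw [hits, ← card_image_of_injective _ h]
  congr 1
  ext e
  simp only [mem_inter, mem_permEdges, mem_image, mem_filter, mem_univ, true_and]
  constructor
  · rintro ⟨⟨x, rfl⟩, h⟩
    exact ⟨x, h, rfl⟩
  · rintro ⟨x, h, rfl⟩
    exact ⟨⟨x, rfl⟩, h⟩

lemma card_filter_pairEdge [DecidableEq V] (hdisj : Disjoint A B)
    (hbip : ∀ u v : V, G.Adj u v → (u ∈ A ∧ v ∈ B) ∨ (u ∈ B ∧ v ∈ A)) {N : Finset (Sym2 V)}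
    (hN : ∀ e ∈ N, e ∈ G.edgeSet) : (univ.filter fun p => pairEdge φ p ∈ N).card = N.card := by
  rw [← card_image_of_injective _ (pairEdge_injective hdisj)]
  congr 1
  ext e
  simp only [mem_image, mem_filter, mem_univ, true_and]
  constructor
  · rintro ⟨p, h, rfl⟩
    exact h
  · intro h
    obtain ⟨p, rfl⟩ := exists_pairEdge_eq (φ := φ) hbip (hN e h)
    exact ⟨p, h, rfl⟩

lemma card_row_le [DecidableEq V] (hdisj : Disjoint A B) {N : Finset (Sym2 V)} {r : ℕ}
    (hr : ∀ v, (N.filter fun e => v ∈ e).card ≤ r) (x : A) :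
    (univ.filter fun y => pairEdge φ (x, y) ∈ N).card ≤ r := by
  refine le_trans (card_le_card_of_injOn (fun y => pairEdge φ (x, y)) (fun y hy => ?_)
    fun y _ y' _ h => congrArg Prod.snd (pairEdge_injective hdisj h)) (hr x)
  simp only [coe_filter, mem_univ, true_and, Set.mem_ofPred_eq] at hy ⊢
  exact ⟨hy, (coe_mem_pairEdge hdisj _ _).2 rfl⟩

lemma card_col_le [DecidableEq V] (hdisj : Disjoint A B) {N : Finset (Sym2 V)} {r : ℕ}
    (hr : ∀ v, (N.filter fun e => v ∈ e).card ≤ r) (y : A) :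
    (univ.filter fun x => pairEdge φ (x, y) ∈ N).card ≤ r := by
  refine le_trans (card_le_card_of_injOn (fun x => pairEdge φ (x, y)) (fun x hx => ?_)
    fun x _ x' _ h => congrArg Prod.fst (pairEdge_injective hdisj h)) (hr (φ y))
  simp only [coe_filter, mem_univ, true_and, Set.mem_ofPred_eq] at hx ⊢
  exact ⟨hx, (coe_equiv_mem_pairEdge hdisj _ _).2 rfl⟩

lemma card_filter_eq_natCard {β : Type*} [Fintype β] {f : β → V} (hf : Function.Injective f)
    (P : β → Prop) [DecidablePred P] (Q : V → Prop) (h : ∀ x, P x ↔ Q (f x))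
    (h' : ∀ v, Q v → ∃ x, f x = v) : (univ.filter P).card = Nat.card {v : V | Q v} := by
  rw [← card_image_of_injective _ hf, ← Set.ncard_coe_finset, ← Nat.card_coe_set_eq]
  congr!
  ext v
  simp only [coe_image, coe_filter, mem_univ, true_and, Set.mem_image, Set.mem_ofPred_eq]
  constructor
  · rintro ⟨x, hx, rfl⟩
    exact (h x).1 hx
  · intro hv
    obtain ⟨x, rfl⟩ := h' v hv
    exact ⟨x, (h x).2 hv, rfl⟩

lemma biRegular_bipRel (hdisj : Disjoint A B)
    (hbip : ∀ u v : V, G.Adj u v → (u ∈ A ∧ v ∈ B) ∨ (u ∈ B ∧ v ∈ A)) {d : ℕ}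
    (hreg : RegularDeg G d) : BiRegular (bipRel G φ) d := by
  constructor
  · intro x
    rw [← hreg x]
    refine card_filter_eq_natCard (Subtype.val_injective.comp φ.injective) _ _
      (fun _ => Iff.rfl) fun v hv => ?_
    obtain ⟨b, hb⟩ := φ.surjective ⟨v, mem_right_of_adj hdisj hbip hv x.2⟩
    exact ⟨b, by simp [hb]⟩
  · intro y
    rw [← hreg (φ y)]
    exact card_filter_eq_natCard Subtype.val_injective _ _ (fun x => G.adj_comm _ _) fun v hv =>
      ⟨⟨v, mem_left_of_adj hdisj hbip hv (φ y).2⟩, rfl⟩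

lemma expands_bipRel (hdisj : Disjoint A B)
    (hbip : ∀ u v : V, G.Adj u v → (u ∈ A ∧ v ∈ B) ∨ (u ∈ B ∧ v ∈ A)) {n τ ν : ℝ} (hn : 0 < n)
    (hν : 0 < ν)
    (hexp : ∀ S : Set V, S ⊆ A → τ * n ≤ (Nat.card S : ℝ) → (Nat.card S : ℝ) ≤ (1 - τ) * n →
      (Nat.card S : ℝ) + ν * n ≤
        (Nat.card {v : V | ν * n ≤ (Nat.card {u : V | u ∈ S ∧ G.Adj v u} : ℝ)} : ℝ))
    (S : Finset A) (h1 : τ * n ≤ S.card) (h2 : (S.card : ℝ) ≤ (1 - τ) * n) :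
    S.card + ν * n ≤ ((univ.filter fun y => ν * n ≤
      ((univ.filter fun z => bipRel G φ z y ∧ z ∈ S).card : ℝ)).card : ℝ) := by
  have hS : Nat.card (Subtype.val '' (S : Set A) : Set V) = S.card := by
    rw [Nat.card_image_of_injective Subtype.val_injective, Nat.card_coe_set_eq,
      Set.ncard_coe_finset]
  have h := hexp (Subtype.val '' (S : Set A)) (by rintro _ ⟨x, -, rfl⟩; exact x.2)
  rw [hS] at h
  refine (h h1 h2).trans (le_of_eq ?_)
  refine (congrArg Nat.cast ?_).symm
  refine card_filter_eq_natCard (Subtype.val_injective.comp φ.injective) _ _ (fun y => ?_)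
    fun v hv => ?_
  · rw [card_filter_eq_natCard (f := Subtype.val) Subtype.val_injective _
      (fun u => u ∈ Subtype.val '' (S : Set A) ∧ G.Adj (φ y) u) (fun z => ?_) fun v hv => ?_]
    · rfl
    · simp [bipRel, G.adj_comm, and_comm]
    · obtain ⟨⟨x, -, rfl⟩, -⟩ := hv
      exact ⟨x, rfl⟩
  · have hpos : 0 < Nat.card {u : V | u ∈ Subtype.val '' (S : Set A) ∧ G.Adj v u} := by
      exact_mod_cast (mul_pos hν hn).trans_le hv
    obtain ⟨⟨⟨u, ⟨x, -, rfl⟩, hu⟩⟩, -⟩ := Nat.card_pos_iff.1 hpos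
    obtain ⟨b, hb⟩ := φ.surjective ⟨v, mem_right_of_adj hdisj hbip hu.symm x.2⟩
    exact ⟨b, by simp [hb]⟩

end Encoding

section Conclusion

open scoped Classical

lemma IsMatchingIn.card_filter_le {V : Type*} {G : SimpleGraph V}
    {N : Finset (Sym2 V)} (h : IsMatchingIn G N) (v : V) :
    (N.filter fun e => v ∈ e).card ≤ 1 := by
  refine card_le_one.2 fun e he f hf => by_contra fun hef => ?_
  rw [mem_filter] at he hf
  exact h.2 e he.1 f hf.1 hef v he.2 hf.2

lemma SpanningRegular.card_filter_eq {V : Type*} {G : SimpleGraph V}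
    {N : Finset (Sym2 V)} {r : ℕ} (h : SpanningRegular G N r) (v : V) :
    (N.filter fun e => v ∈ e).card = r := by
  rw [← h.2 v]
  exact (Nat.subtype_card _ (by simp)).symm

variable {α : Type*} [Fintype α] [DecidableEq α] {E : α → α → Prop} {d k r : ℕ} {T η θ γ ε : ℝ}

lemma Switchable.edge_bounds (h : Switchable E d k r T η θ) (hγ : γ = η + 2 * θ + 4 * r / d)
    (hγ1 : γ ≤ 1 / 3) (hγε : 3 * γ ≤ ε) (hne : (matchings E).Nonempty) {a b : α} (hE : E a b) :
    (1 - ε) / d ≤ (((matchings E).filter fun σ => σ a = b).card : ℝ) / (matchings E).card ∧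
    (((matchings E).filter fun σ => σ a = b).card : ℝ) / (matchings E).card ≤ (1 + ε) / d := by
  have hd : (0 : ℝ) < d := by exact_mod_cast h.one_le_d
  have ht : (0 : ℝ) < (matchings E).card := by exact_mod_cast hne.card_pos
  have h1 := abs_le.1 (h.abs_card_sub_le hγ hγ1 hE)
  have h2 : 3 * γ * (matchings E).card ≤ ε * (matchings E).card := by gcongr
  rw [div_le_div_iff₀ hd ht, div_le_div_iff₀ ht hd]
  constructor <;> linarith

lemma Switchable.tsum_abs_sub_le (h : Switchable E d k r T η θ)
    (hγ : γ = η + 2 * θ + 4 * r / d) (hγ1 : γ ≤ 1 / 3) (hε : 0 ≤ ε)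
    (hne : (matchings E).Nonempty) {N : Finset (α × α)}
    (hN₁ : ∀ x, (univ.filter fun y => (x, y) ∈ N).card ≤ r)
    (hN₂ : ∀ y, (univ.filter fun x => (x, y) ∈ N).card ≤ r) (hN : ∀ p ∈ N, E p.1 p.2)
    (hγε : 8 * γ * (N.card / d) ≤ ε) :
    1 / 2 * ∑' j, |(((matchings E).filter fun σ => hits N σ = j).card : ℝ) /
      (matchings E).card - poissonPMF (N.card / d) j| ≤ ε := by
  have hd : (0 : ℝ) < d := by exact_mod_cast h.one_le_d
  rcases N.eq_empty_or_nonempty with rfl | hN0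
  · rw [card_empty, Nat.cast_zero, zero_div,
      tsum_abs_sub_poissonPMF_zero _ hne (hits ∅) fun σ _ => by simp [hits]]
    simpa using hε
  · have hN0' : (0 : ℝ) < N.card := by exact_mod_cast hN0.card_pos
    refine tsum_abs_sub_poissonPMF_le _ hne (hits N) (by positivity) fun g hg => ?_
    refine (h.abs_sum_hits_mul_sub_le hγ hγ1 hN₁ hN₂ hN g hg).trans ?_
    refine mul_le_mul_of_nonneg_right (le_of_eq_of_le ?_ hγε) (Nat.cast_nonneg _)
    ring

lemma card_le_mul_of_row_le {N : Finset (α × α)}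
    (hN : ∀ x, (univ.filter fun y => (x, y) ∈ N).card ≤ r) : N.card ≤ r * Fintype.card α := by
  refine card_le_mul_card_image_of_maps_to (f := Prod.fst) (t := univ) (fun _ _ => mem_univ _) r
    fun x _ => ?_
  refine le_trans (card_le_card_of_injOn Prod.snd (fun p hp => ?_) fun p hp q hq hpq => ?_) (hN x)
  · simp only [coe_filter, mem_univ, true_and, Set.mem_ofPred_eq] at hp ⊢
    rw [← hp.2]
    exact hp.1
  · exact Prod.ext ((mem_filter.1 hp).2.trans (mem_filter.1 hq).2.symm) hpq

end Conclusion

/-- bipartite analogue. Let `G` be a `d`-regular bipartite robust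
`(ν,τ)`-expander with parts of size `n`, and let `N` be a matching or a spanning
`r`-regular subgraph of `G`. Then every edge lies in a uniformly random perfect matching
`M` with probability `(1 ± ε)/d`, and `|M ∩ E(N)|` is within total variation distance
`ε` of a Poisson distribution with mean `e(N)/d`. -/
theorem bipartite_poisson_approximation :
    ∀ δ : ℝ, 0 < δ →
    ∃ τ : ℝ, 0 < τ ∧
    ∀ ν : ℝ, 0 < ν →
    ∀ ε : ℝ, 0 < ε →
    ∃ n₀ : ℕ, ∀ n : ℕ, n₀ ≤ n →
    ∀ d : ℕ, δ * (n : ℝ) ≤ (d : ℝ) →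
    ∀ r : ℕ, 1 ≤ r → (r : ℝ) ≤ (n : ℝ) ^ ((1 : ℝ) / 50) →
    ∀ (V : Type) [Fintype V] [DecidableEq V],
    ∀ A B : Set V, A ∪ B = Set.univ → Disjoint A B → Nat.card A = n → Nat.card B = n →
    ∀ G : SimpleGraph V,
      -- `G` is bipartite with parts `A` and `B`
      (∀ u v : V, G.Adj u v → (u ∈ A ∧ v ∈ B) ∨ (u ∈ B ∧ v ∈ A)) →
      -- `G` is `d`-regular
      RegularDeg G d →
      -- `G` is a bipartite robust `(ν,τ)`-expander
      (∀ S : Set V, S ⊆ A →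
        τ * (n : ℝ) ≤ (Nat.card S : ℝ) → (Nat.card S : ℝ) ≤ (1 - τ) * (n : ℝ) →
        (Nat.card S : ℝ) + ν * (n : ℝ) ≤
          (Nat.card {v : V | ν * (n : ℝ) ≤ (Nat.card {u : V | u ∈ S ∧ G.Adj v u} : ℝ)} : ℝ)) →
    pmCount G ≠ 0 →
    ∀ N : Finset (Sym2 V), (IsMatchingIn G N ∨ SpanningRegular G N r) →
      (∀ e ∈ G.edgeSet,
        (1 - ε) / (d : ℝ) ≤ edgeProb G e ∧ edgeProb G e ≤ (1 + ε) / (d : ℝ)) ∧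
      (1 / 2) * ∑' k : ℕ, |interProb G N k - poissonPMF ((N.card : ℝ) / (d : ℝ)) k| ≤ ε := by
  classical
  intro δ hδ
  refine ⟨δ / 2, by positivity, fun ν hν ε hε => ?_⟩
  obtain ⟨n₀, hn₀⟩ := exists_switchable hδ hν hε
  refine ⟨max n₀ 1, fun n hn d hd r hr1 hr V _ _ A B hun hdisj hA hB G hbip hreg hexp hpm N hN => ?_⟩
  have hn1 : 1 ≤ n := (le_max_right _ _).trans hn
  have hn0 : (0 : ℝ) < n := by exact_mod_cast hn1
  have hd0 : (0 : ℝ) < d := lt_of_lt_of_le (by positivity) hd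
  let _ : Fintype A := Fintype.ofFinite A
  let _ : DecidableEq A := Classical.decEq A
  obtain ⟨φ⟩ : Nonempty (A ≃ B) := Finite.card_eq.1 (hA.trans hB.symm)
  have hcard : Fintype.card A = n := by rw [← Nat.card_eq_fintype_card, hA]
  obtain ⟨k, T, η, θ, γ, hsw, hγ, hγ1, hγ3, hγ8⟩ := hn₀ n ((le_max_left _ _).trans hn) d hd r hr1 hr
    A hcard (bipRel G φ) (biRegular_bipRel hdisj hbip hreg) fun S h1 h2 => by
      convert expands_bipRel (φ := φ) hdisj hbip hn0 hν hexp S h1 h2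
  have hNG : ∀ e ∈ N, e ∈ G.edgeSet := hN.elim And.left And.left
  have hNr : ∀ v, (N.filter fun e => v ∈ e).card ≤ r := fun v => by
    rcases hN with h | h
    · refine le_of_eq_of_le ?_ ((h.card_filter_le v).trans hr1)
      congr!
    · refine le_of_eq ?_
      convert h.card_filter_eq v
  have hcount := card_isPM_and (φ := φ) hun hdisj hbip
  have hpm' : pmCount G = (matchings (bipRel G φ)).card := by
    have h := hcount fun _ => True
    rw [filter_true] at h
    rw [← h, pmCount]
    simp
  have hne : (matchings (bipRel G φ)).Nonempty := by
    rw [← card_pos, ← hpm']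
    exact Nat.pos_of_ne_zero hpm
  set N' : Finset (A × A) := univ.filter fun p => pairEdge φ p ∈ N with hN'
  have hN'card : N'.card = N.card := card_filter_pairEdge hdisj hbip hNG
  have hN₁ : ∀ x, (univ.filter fun y => (x, y) ∈ N').card ≤ r := fun x => by
    simpa [hN'] using card_row_le (φ := φ) hdisj hNr x
  have hN₂ : ∀ y, (univ.filter fun x => (x, y) ∈ N').card ≤ r := fun y => by
    simpa [hN'] using card_col_le (φ := φ) hdisj hNr y
  have hN'E : ∀ p ∈ N', bipRel G φ p.1 p.2 := fun p hp =>
    (pairEdge_mem_edgeSet p).1 (hNG _ (mem_filter.1 hp).2)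
  constructor
  · intro e he
    obtain ⟨⟨a, b⟩, rfl⟩ := exists_pairEdge_eq (φ := φ) hbip he
    have h := hsw.edge_bounds hγ hγ1 hγ3 hne ((pairEdge_mem_edgeSet _).1 he)
    rw [edgeProb, hcount, hpm']
    simp only [pairEdge_mem_permEdges hdisj]
    convert h
  · have hγ0 : 0 ≤ γ := by
      have := hsw.η_nonneg
      have := hsw.θ_nonneg
      rw [hγ]
      positivity
    have hlam : (N'.card : ℝ) / d ≤ r / δ := by
      have h : (N'.card : ℝ) ≤ r * n := by
        rw [← hcard]
        exact_mod_cast card_le_mul_of_row_le hN₁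
      rw [div_le_div_iff₀ hd0 hδ]
      calc (N'.card : ℝ) * δ ≤ r * n * δ := by gcongr
        _ = r * (δ * n) := by ring
        _ ≤ r * d := by gcongr
    have h := hsw.tsum_abs_sub_le hγ hγ1 hε.le hne hN₁ hN₂ hN'E
      (le_trans (by gcongr) hγ8)
    rw [hN'card] at h
    refine le_of_eq_of_le ?_ h
    congr! 5 with j
    rw [interProb, hcount fun M => (M ∩ N).card = j, hpm']
    simp only [card_permEdges_inter hdisj]
    congr!

end RPM
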